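/- arXiv:2604.02496 — 4 statements merged into one kernel-verified Lean document; each statement's English description precedes it below -/
import Mathlib

section
/- Let H be a partial route and ξ ∈ [N] a scenario such that the LP defining L*_ξ(H) is feasible. Then there exists an optimal solution (ᾱ^ξ, β̄^ξ) of the dual LP — maximize Σ_{H'⊆H} α^ξ_{H'}(k_ξ(H') − 1) + Σ_{v∈V₊} β^ξ_v b_v subject to Σ_{H'⊆H : v∈V₊(H')} α^ξ_{H'} + β^ξ_v ≤ w_v for all v ∈ V₊(H), α^ξ ≥ 0, β^ξ ≤ 0 — satisfying both Σ_{H'⊆H} ᾱ^ξ_{H'} ≤ L*_ξ(H) and Σ_{H'⊆H : v∈V₊(H')} ᾱ^ξ_{H'} + β̄^ξ_v ≤ 0 for every v ∈ V₊ with w_v = 0. -/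
set_option autoImplicit false

open Finset

namespace VRPSD

variable {Vp : Type*} [Fintype Vp] [DecidableEq Vp]
variable {Sc : Type*} [Fintype Sc] [Nonempty Sc]

/-- Position `j` of the closed walk `0, v₁, …, v_ℓ, 0`:
`j = 0` gives the depot (`none`), `1 ≤ j ≤ ℓ` gives customer `v_j`,
and `j ≥ ℓ + 1` gives the depot again. -/
def nodeAt (L : List Vp) (j : ℕ) : Option Vp :=
  if j = 0 then none else L[j-1]?

/-- Directed flow feasibility (Formulation (1) of the paper) witnessing recourse action `y`
for the directed route given by the list `L = [v₁, …, v_ℓ]`, demand vector `d` and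
vehicle capacity `C`. -/
def FlowFeasible (C : ℚ) (d : Vp → ℚ) (L : List Vp) (y : Vp → ℝ) : Prop :=
  ∃ (f : Option Vp → Option Vp → ℝ) (g : Vp → ℝ),
    (∀ a b, 0 ≤ f a b) ∧ (∀ v, 0 ≤ g v) ∧
    (∀ j : Fin L.length,
      f (nodeAt L j.val) (nodeAt L (j.val + 1)) + (d (L.get j) : ℝ)
        = f (nodeAt L (j.val + 1)) (nodeAt L (j.val + 2)) + g (L.get j)) ∧
    (∀ j : Fin (L.length + 1), f (nodeAt L j.val) (nodeAt L (j.val + 1)) ≤ (C : ℝ)) ∧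
    (∀ j : Fin L.length, g (L.get j) ≤ (C : ℝ) * y (L.get j))

/-- `𝒴^ξ(→R)` : the set of recourse actions for the directed route `L` and a fixed scenario
with demand vector `d`: nonnegative integer vectors admitting a feasible flow. -/
def RecourseActions (C : ℚ) (d : Vp → ℚ) (L : List Vp) : Set (Vp → ℝ) :=
  {y | (∀ v, 0 ≤ y v) ∧ (∀ v, ∃ m : ℤ, y v = (m : ℝ)) ∧ FlowFeasible C d L y}

/-- `Π(R)` : the set of recourse policies for route `L`. -/
def Policies (C : ℚ) (d : Sc → Vp → ℚ) (L : List Vp) : Set (Sc → Vp → ℝ) :=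
  {y | ∀ ξ, y ξ ∈ RecourseActions C (d ξ) L}

/-- `[0,b]^N`. -/
def Box (b : Vp → ℤ) : Set (Sc → Vp → ℝ) :=
  {y | ∀ ξ v, 0 ≤ y ξ v ∧ y ξ v ≤ (b v : ℝ)}

/-- `x(δ(v))` for a customer `v`. -/
noncomputable def degCust (x : Option Vp → Option Vp → ℝ) (v : Vp) : ℝ :=
  ∑ u ∈ univ.filter (fun u => u ≠ some v), x u (some v)

/-- `x(δ(0))`. -/
noncomputable def degDepot (x : Option Vp → Option Vp → ℝ) : ℝ :=
  ∑ u ∈ univ.filter (fun u => u ≠ (none : Option Vp)), x u none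

/-- `x(E(S))` for a customer set `S`. -/
noncomputable def inSum (x : Option Vp → Option Vp → ℝ) (S : Finset Vp) : ℝ :=
  (1/2) * ∑ u ∈ S, ∑ v ∈ S.filter (fun v => v ≠ u), x (some u) (some v)

/-- The subtour-elimination polytope `𝒳_sub` (symmetric edge variables). -/
def Xsub : Set (Option Vp → Option Vp → ℝ) :=
  {x | (∀ u v, x u v = x v u) ∧ (∀ u, x u u = 0) ∧
       (∀ u v, u ≠ v → 0 ≤ x u v ∧ x u v ≤ 2) ∧
       (∀ v : Vp, degCust x v = 2) ∧
       (∀ S : Finset Vp, S.Nonempty → inSum x S ≤ (S.card : ℝ) - 1)}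

/-- `k_ξ(S) = ⌈d^ξ(S)/C⌉`. -/
def kxi (C : ℚ) (d : Vp → ℚ) (S : Finset Vp) : ℤ := ⌈(∑ v ∈ S, d v) / C⌉

/-- The CVRP-feasible polytope `𝒳_cvrp`. -/
def Xcvrp (C : ℚ) (p : Sc → ℚ) (d : Sc → Vp → ℚ) (k : ℕ) :
    Set (Option Vp → Option Vp → ℝ) :=
  Xsub ∩ {x | degDepot x = 2 * (k : ℝ) ∧
    ∀ S : Finset Vp, S.Nonempty →
      inSum x S ≤ (S.card : ℝ) - ((⌈(∑ v ∈ S, ∑ ξ, p ξ * d ξ v) / C⌉ : ℤ) : ℝ)}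

/-- A routing plan: a collection of routes whose customer sets partition `V₊`. -/
def IsRoutingPlan (Rs : List (List Vp)) : Prop :=
  (∀ L ∈ Rs, L ≠ [] ∧ L.Nodup) ∧
  ∀ v : Vp, ∃! i : Fin Rs.length, v ∈ Rs.get i

/-- The incidence vector of the edges of a single route `L` (closed walk through the depot). -/
noncomputable def routeInc (L : List Vp) (u u' : Option Vp) : ℝ :=
  ∑ j ∈ Finset.range (L.length + 1),
    (if (nodeAt L j = u ∧ nodeAt L (j+1) = u') ∨ (nodeAt L j = u' ∧ nodeAt L (j+1) = u)
     then (1 : ℝ) else 0)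

/-- The incidence vector `x̄` of a routing plan. -/
noncomputable def planInc (Rs : List (List Vp)) (u u' : Option Vp) : ℝ :=
  (Rs.map (fun L => routeInc L u u')).sum

/-- The set `FLOW(x̄)`. -/
def FLOW (C : ℚ) (d : Sc → Vp → ℚ) (b : Vp → ℤ) (x : Option Vp → Option Vp → ℝ) :
    Set (Sc → Vp → ℝ) :=
  {y | y ∈ Box b ∧
    ∃ (f : Sc → Option Vp → Option Vp → ℝ) (g : Sc → Vp → ℝ),
      (∀ ξ a c, 0 ≤ f ξ a c) ∧ (∀ ξ v, 0 ≤ g ξ v) ∧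
      (∀ ξ (v : Vp),
        (∑ u ∈ univ.filter (fun u => u ≠ some v), f ξ u (some v)) + (d ξ v : ℝ)
          = (∑ u ∈ univ.filter (fun u => u ≠ some v), f ξ (some v) u) + g ξ v) ∧
      (∀ ξ (u u' : Option Vp), u ≠ u' → f ξ u u' ≤ ((C : ℝ)/2) * x u u') ∧
      (∀ ξ v, g ξ v ≤ (C : ℝ) * y ξ v)}

/-- The set `SRI(x̄)` (on the `y`-variables only). -/
def SRIy (C : ℚ) (d : Sc → Vp → ℚ) (b : Vp → ℤ) (x : Option Vp → Option Vp → ℝ) :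
    Set (Sc → Vp → ℝ) :=
  {y | y ∈ Box b ∧ ∀ S : Finset Vp, S.Nonempty → ∀ ξ,
    ((kxi C (d ξ) S : ℝ) + inSum x S - (S.card : ℝ)) ≤ ∑ v ∈ S, y ξ v}

/-- The recourse cost `Σ_ξ Σ_v p_ξ w_v y^ξ_v`. -/
noncomputable def cost (p : Sc → ℚ) (w : Vp → ℚ) (y : Sc → Vp → ℝ) : ℝ :=
  ∑ ξ, ∑ v, (p ξ : ℝ) * (w v : ℝ) * y ξ v

/-- `ν(α,β)`. -/
noncomputable def nu (C : ℚ) (d : Sc → Vp → ℚ) (b : Vp → ℤ)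
    (α : Sc → Finset Vp → ℝ) (β : Sc → Vp → ℝ) : ℝ :=
  (∑ ξ, ∑ S ∈ univ.filter (fun S : Finset Vp => S ≠ ∅),
      α ξ S * ((kxi C (d ξ) S : ℝ) - (S.card : ℝ)))
  + ∑ ξ, ∑ v, β ξ v * (b v : ℝ)

/-- `φ_v(α,β)` (only meaningful for `v` with `w v > 0`). -/
noncomputable def phiv (p : Sc → ℚ) (w : Vp → ℚ)
    (α : Sc → Finset Vp → ℝ) (β : Sc → Vp → ℝ) (v : Vp) : ℝ :=
  max (Finset.univ.sup' Finset.univ_nonempty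
    (fun ξ => (β ξ v + ∑ S ∈ univ.filter (fun S : Finset Vp => v ∈ S), α ξ S)
      / ((p ξ : ℝ) * (w v : ℝ)))) 0

/-- The set `𝒜` of multipliers. -/
def multA (w : Vp → ℚ) (α : Sc → Finset Vp → ℝ) (β : Sc → Vp → ℝ) : Prop :=
  (∀ ξ (S : Finset Vp), S ≠ ∅ → 0 ≤ α ξ S) ∧ (∀ ξ v, β ξ v ≤ 0) ∧
  (∀ ξ v, w v = 0 →
    β ξ v + (∑ S ∈ univ.filter (fun S : Finset Vp => v ∈ S), α ξ S) ≤ 0)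

/-- The set `ŜRI(x̄)` of pairs `(θ, y)`. -/
def SRIhat (C : ℚ) (d : Sc → Vp → ℚ) (p : Sc → ℚ) (w : Vp → ℚ) (b : Vp → ℤ)
    (x : Option Vp → Option Vp → ℝ) : Set ((Vp → ℝ) × (Sc → Vp → ℝ)) :=
  {θy | (∀ v, 0 ≤ θy.1 v) ∧ θy.2 ∈ Box b ∧
    (∀ S : Finset Vp, S.Nonempty → ∀ ξ,
      ((kxi C (d ξ) S : ℝ) + inSum x S - (S.card : ℝ)) ≤ ∑ v ∈ S, θy.2 ξ v) ∧
    (∀ v, (∑ ξ, (p ξ : ℝ) * (w v : ℝ) * θy.2 ξ v) ≤ θy.1 v)}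

/-- The polyhedron `𝒫`. -/
def Pset (X : Set (Option Vp → Option Vp → ℝ)) (C : ℚ) (d : Sc → Vp → ℚ)
    (p : Sc → ℚ) (w : Vp → ℚ) (b : Vp → ℤ) :
    Set ((Option Vp → Option Vp → ℝ) × (Vp → ℝ)) :=
  {xθ | xθ.1 ∈ X ∧ ∃ y, (xθ.2, y) ∈ SRIhat C d p w b xθ.1}

/-- The set `Γ(x̄, α, β)`. -/
def GammaSet (C : ℚ) (d : Sc → Vp → ℚ) (p : Sc → ℚ) (w : Vp → ℚ) (b : Vp → ℤ)
    (x : Option Vp → Option Vp → ℝ) (α : Sc → Finset Vp → ℝ) (β : Sc → Vp → ℝ) :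
    Set ((Vp → ℝ) × (Sc → Vp → ℝ)) :=
  {θy | (∀ v, 0 ≤ θy.1 v) ∧ θy.2 ∈ Box b ∧
    ((∑ ξ, ∑ S ∈ univ.filter (fun S : Finset Vp => S ≠ ∅), α ξ S * inSum x S)
        + nu C d b α β
      ≤ ∑ ξ, ∑ v, (β ξ v + ∑ S ∈ univ.filter (fun S : Finset Vp => v ∈ S), α ξ S)
          * θy.2 ξ v) ∧
    (∀ v, (∑ ξ, (p ξ : ℝ) * (w v : ℝ) * θy.2 ξ v) ≤ θy.1 v)}

/-- `V₊(H)` for a partial route given as a list of customer sets. -/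
def VplusH (Hs : List (Finset Vp)) : Finset Vp := Hs.foldr (· ∪ ·) ∅

/-- `x(E(S,T))` for disjoint customer sets `S`, `T`. -/
noncomputable def crossSum (x : Option Vp → Option Vp → ℝ) (S T : Finset Vp) : ℝ :=
  ∑ u ∈ S, ∑ v ∈ T, x (some u) (some v)

/-- `x(H)` for a partial route `H`. -/
noncomputable def xH (x : Option Vp → Option Vp → ℝ) (Hs : List (Finset Vp)) : ℝ :=
  (Hs.map (fun S => inSum x S)).sum
    + (List.zipWith (fun S T => crossSum x S T) Hs Hs.tail).sum

/-- The activation function `W_OF(x ; H)`. -/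
noncomputable def WOF (x : Option Vp → Option Vp → ℝ) (Hs : List (Finset Vp)) : ℝ :=
  1 + (xH x Hs - ((VplusH Hs).card : ℝ) + 1)
    + ∑ i ∈ ({2, Hs.length - 1} : Finset ℕ) ∩ Finset.Icc 1 Hs.length,
        (inSum x (Hs.getD (i-1) ∅) - ((Hs.getD (i-1) ∅).card : ℝ) + 1)

/-- A partial route: pairwise disjoint nonempty customer sets,
no two consecutive non-singletons. -/
def IsPartialRoute (Hs : List (Finset Vp)) : Prop :=
  Hs ≠ [] ∧ (∀ S ∈ Hs, S.Nonempty) ∧ Hs.Pairwise Disjoint ∧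
  Hs.Chain' (fun S T => S.card = 1 ∨ T.card = 1)

/-- Indices `(i,j)`, `i ≤ j`, of the contiguous sub-tuples of a partial route. -/
def segIdx (Hs : List (Finset Vp)) : Finset (ℕ × ℕ) :=
  (Finset.range Hs.length ×ˢ Finset.range Hs.length).filter fun q => q.1 ≤ q.2

/-- The customer set `V₊(H')` of the contiguous sub-tuple `H' = (S_i, …, S_j)` (0-based). -/
def seg (Hs : List (Finset Vp)) (i j : ℕ) : Finset Vp :=
  VplusH ((Hs.drop i).take (j + 1 - i))

/-- `cᵀ x` for symmetric edge functions. -/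
noncomputable def dotE (c x : Option Vp → Option Vp → ℝ) : ℝ :=
  (1/2) * ∑ u : Option Vp, ∑ v ∈ univ.filter (fun v => v ≠ u), c u v * x u v

end VRPSD

namespace VRPSD

variable {Vp : Type*} [Fintype Vp] [DecidableEq Vp]

lemma claim16 {ι V : Type*} (Q : Finset ι) (S : ι → Finset V)
    (m : ι → ℤ) (b : V → ℤ) (hb : ∀ v, 0 ≤ b v) (t : ℝ) (ht0 : 0 ≤ t) (ht1 : t < 1)
    (y : V → ℝ) (hy : ∀ v, 0 ≤ y v ∧ y v ≤ (b v : ℝ))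
    (hf : ∀ q ∈ Q, (m q : ℝ) - t ≤ ∑ v ∈ S q, y v) :
    ∀ q ∈ Q, (m q : ℝ) ≤ ∑ v ∈ S q, min (b v : ℝ) (y v / (1 - t)) := by
  classical
  intro q hq
  have h1 : 0 < 1 - t := by linarith
  have hpos : ∀ v, 0 ≤ min (b v : ℝ) (y v / (1 - t)) := fun v =>
    le_min (by exact_mod_cast hb v) (div_nonneg (hy v).1 h1.le)
  let p : V → Prop := fun v => (b v : ℝ) ≤ y v / (1 - t)
  have e1 : ∑ v ∈ S q with p v, min (b v : ℝ) (y v / (1 - t)) = ((∑ v ∈ S q with p v, b v : ℤ) : ℝ) := by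
    push_cast
    refine Finset.sum_congr rfl fun v hv => ?_
    exact min_eq_left (Finset.mem_filter.1 hv).2
  have e2 : ∑ v ∈ S q with ¬ p v, min (b v : ℝ) (y v / (1 - t))
      = (∑ v ∈ S q with ¬ p v, y v) / (1 - t) := by
    rw [Finset.sum_div]
    refine Finset.sum_congr rfl fun v hv => ?_
    exact min_eq_right (not_le.1 (Finset.mem_filter.1 hv).2).le
  have e3 : ∑ v ∈ S q with p v, y v ≤ ((∑ v ∈ S q with p v, b v : ℤ) : ℝ) := by
    push_cast
    exact Finset.sum_le_sum fun v _ => (hy v).2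
  have hs := Finset.sum_filter_add_sum_filter_not (S q) p y
  have hq' := hf q hq
  have hn : 0 ≤ ∑ v ∈ S q with ¬ p v, y v := Finset.sum_nonneg fun v _ => (hy v).1
  rw [← Finset.sum_filter_add_sum_filter_not (S q) p, e1, e2]
  set B : ℤ := ∑ v ∈ S q with p v, b v
  rcases le_or_gt (m q) B with h | h
  · have : (m q : ℝ) ≤ B := by exact_mod_cast h
    have := div_nonneg hn h1.le
    linarith
  · have h' : (B : ℝ) + 1 ≤ m q := by exact_mod_cast h
    have : (m q : ℝ) - B ≤ (∑ v ∈ S q with ¬ p v, y v) / (1 - t) := by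
      rw [le_div_iff₀ h1]
      nlinarith
    linarith

lemma core16 {ι V : Type*} [DecidableEq ι] [Fintype V] [DecidableEq V] (Q : Finset ι)
    (S : ι → Finset V) (U : Finset V) (hSU : ∀ q ∈ Q, S q ⊆ U)
    (m : ι → ℤ) (w : V → ℝ) (hw : ∀ v, 0 ≤ w v) (b : V → ℤ) (hb : ∀ v, 0 ≤ b v)
    (L : ℝ) (hL : 0 ≤ L)
    (hLle : ∀ y : V → ℝ, (∀ v, 0 ≤ y v ∧ y v ≤ (b v : ℝ)) →
      (∀ q ∈ Q, (m q : ℝ) ≤ ∑ v ∈ S q, y v) → L ≤ ∑ v ∈ U, w v * y v) :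
    ∃ (α : ι → ℝ) (β : V → ℝ), (∀ q ∈ Q, 0 ≤ α q) ∧ (∀ v, β v ≤ 0) ∧
      (∀ v ∈ U, (∑ q ∈ Q.filter (fun q => v ∈ S q), α q) + β v ≤ w v) ∧
      L ≤ (∑ q ∈ Q, α q * (m q : ℝ)) + ∑ v, β v * (b v : ℝ) ∧
      ∑ q ∈ Q, α q ≤ L := by
  let X : Set (V → ℝ) := Set.pi Set.univ fun v => Set.Icc 0 (b v : ℝ)
  let Y : Set (ι → ℝ) := (Set.pi Set.univ fun _ => Set.Icc 0 L) ∩ {α | ∑ q ∈ Q, α q ≤ L}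
  let f : (V → ℝ) → (ι → ℝ) → ℝ := fun y α =>
    ∑ q ∈ Q, α q * ((m q : ℝ) - ∑ v ∈ S q, y v) + ∑ v ∈ U, w v * y v
  have hX : ∀ y, y ∈ X ↔ ∀ v, 0 ≤ y v ∧ y v ≤ (b v : ℝ) := by
    intro y; simp only [X, Set.mem_pi, Set.mem_univ, true_imp_iff, Set.mem_Icc]
  have hY0 : (0 : ι → ℝ) ∈ Y := by
    refine ⟨fun _ _ => ⟨le_rfl, hL⟩, ?_⟩
    simpa using hL
  have cX : Convex ℝ X := convex_pi fun v _ => convex_Icc _ _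
  have cS : Convex ℝ {α : ι → ℝ | ∑ q ∈ Q, α q ≤ L} := by
    intro x hx y hy s t hs ht hst
    simp only [Set.mem_setOf_eq, Pi.add_apply, Pi.smul_apply, smul_eq_mul,
      Finset.sum_add_distrib, ← Finset.mul_sum] at *
    have : L = s * L + t * L := by rw [← add_mul, hst, one_mul]
    rw [this]
    gcongr
  have cY : Convex ℝ Y := (convex_pi fun v _ => convex_Icc _ _).inter cS
  have kX : IsCompact X := isCompact_univ_pi fun v => isCompact_Icc
  have kY : IsCompact Y := (isCompact_univ_pi fun v => isCompact_Icc).inter_right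
    (isClosed_le (by fun_prop) continuous_const)
  have hsub : ∀ y y' : V → ℝ, ∀ α, ∀ s t : ℝ, s + t = 1 →
      f (s • y + t • y') α = s * f y α + t * f y' α := by
    intro y y' α s t hst
    have h1 : ∀ q, α q * ((m q : ℝ) - ∑ v ∈ S q, (s • y + t • y') v)
        = s * (α q * ((m q : ℝ) - ∑ v ∈ S q, y v)) + t * (α q * ((m q : ℝ) - ∑ v ∈ S q, y' v)) := by
      intro q
      simp only [Pi.add_apply, Pi.smul_apply, smul_eq_mul, Finset.sum_add_distrib, ← Finset.mul_sum]
      linear_combination (-(α q * (m q : ℝ))) * hst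
    have h2 : ∀ v, w v * (s • y + t • y') v = s * (w v * y v) + t * (w v * y' v) := by
      intro v
      simp only [Pi.add_apply, Pi.smul_apply, smul_eq_mul]
      ring
    simp only [f, h1, h2, Finset.sum_add_distrib, ← Finset.mul_sum]
    ring
  have hsubα : ∀ y, ∀ α α', ∀ s t : ℝ, s + t = 1 →
      f y (s • α + t • α') = s * f y α + t * f y α' := by
    intro y α α' s t hst
    have h1 : ∀ q, (s • α + t • α') q * ((m q : ℝ) - ∑ v ∈ S q, y v)
        = s * (α q * ((m q : ℝ) - ∑ v ∈ S q, y v)) + t * (α' q * ((m q : ℝ) - ∑ v ∈ S q, y v)) := by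
      intro q
      simp only [Pi.add_apply, Pi.smul_apply, smul_eq_mul]
      ring
    simp only [f, h1, Finset.sum_add_distrib, ← Finset.mul_sum]
    linear_combination (-(∑ v ∈ U, w v * y v)) * hst
  obtain ⟨a, ha, α, hα, hsad⟩ := Sion.exists_isSaddlePointOn (X := X) (Y := Y) (f := f)
    ⟨0, (hX 0).2 fun v => ⟨le_rfl, (Int.cast_nonneg (hb v) : (0 : ℝ) ≤ (b v : ℝ))⟩⟩ cX kX
    (fun α _ => (Continuous.lowerSemicontinuous
      (show Continuous (fun y => f y α) by fun_prop)).lowerSemicontinuousOn _)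
    (fun α _ => ConvexOn.quasiconvexOn ⟨cX, fun y _ y' _ s t _ _ hst => (hsub y y' α s t hst).le⟩)
    cY ⟨0, hY0⟩ kY
    (fun y _ => (Continuous.upperSemicontinuous
      (show Continuous (fun α => f y α) by fun_prop)).upperSemicontinuousOn _)
    (fun y _ => ConcaveOn.quasiconcaveOn ⟨cY, fun α _ α' _ s t _ _ hst => (hsubα y α α' s t hst).ge⟩)
  have ha' := (hX a).1 ha
  have hwa : 0 ≤ ∑ v ∈ U, w v * a v := Finset.sum_nonneg fun v _ => mul_nonneg (hw v) (ha' v).1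
  have key : ∃ α' ∈ Y, L ≤ f a α' := by
    by_cases hfe : ∀ q ∈ Q, (m q : ℝ) ≤ ∑ v ∈ S q, a v
    · refine ⟨0, hY0, ?_⟩
      simpa [f] using hLle a ha' hfe
    · push Not at hfe
      obtain ⟨q0, hq0, hlt⟩ := hfe
      obtain ⟨q, hq, hmax⟩ := Finset.exists_max_image Q
        (fun q => (m q : ℝ) - ∑ v ∈ S q, a v) ⟨q0, hq0⟩
      set t := (m q : ℝ) - ∑ v ∈ S q, a v with ht
      have ht0 : 0 < t := by have := hmax q0 hq0; linarith
      refine ⟨fun q' => if q' = q then L else 0, ⟨?_, ?_⟩, ?_⟩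
      · intro q' _
        dsimp only
        split_ifs
        · exact ⟨hL, le_rfl⟩
        · exact ⟨le_rfl, hL⟩
      · simp [hq]
      · have e : f a (fun q' => if q' = q then L else 0) = L * t + ∑ v ∈ U, w v * a v := by
          simp [f, hq, ht]
        rw [e]
        rcases le_or_gt 1 t with h | h
        · nlinarith
        · have h1 : 0 < 1 - t := by linarith
          have hcl := claim16 Q S m b hb t ht0.le h a ha'
            (fun q' hq' => by have := hmax q' hq'; linarith)
          have hle := hLle _ (fun v => ⟨le_min (by exact_mod_cast hb v)
            (div_nonneg (ha' v).1 h1.le), min_le_left _ _⟩) hcl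
          have h2 : ∑ v ∈ U, w v * min (b v : ℝ) (a v / (1 - t))
              ≤ (∑ v ∈ U, w v * a v) / (1 - t) := by
            rw [Finset.sum_div]
            refine Finset.sum_le_sum fun v _ => ?_
            rw [mul_div_assoc]
            exact mul_le_mul_of_nonneg_left (min_le_right _ _) (hw v)
          have h3 := hle.trans h2
          rw [le_div_iff₀ h1] at h3
          linarith
  obtain ⟨α', hα', hLa⟩ := key
  let A : V → ℝ := fun v => ∑ q ∈ Q.filter (fun q => v ∈ S q), α q
  let y : V → ℝ := fun v => if v ∈ U ∧ w v < A v then (b v : ℝ) else 0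
  let β : V → ℝ := fun v => if v ∈ U ∧ w v < A v then w v - A v else 0
  refine ⟨α, β, fun q _ => (hα.1 q trivial).1, ?_, ?_, ?_, hα.2⟩
  · intro v
    simp only [β]
    split_ifs with h
    · linarith [h.2]
    · exact le_rfl
  · intro v hv
    change A v + β v ≤ w v
    simp only [β]
    split_ifs with h
    · linarith
    · have : ¬ w v < A v := fun h' => h ⟨hv, h'⟩
      linarith
  · have hyX : y ∈ X := (hX y).2 fun v => by
      have : (0 : ℝ) ≤ b v := by exact_mod_cast hb v
      simp only [y]
      split_ifs
      · exact ⟨this, le_rfl⟩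
      · exact ⟨le_rfl, this⟩
    refine (hLa.trans (hsad y hyX α' hα')).trans (le_of_eq ?_)
    have h1 : ∑ q ∈ Q, α q * ∑ v ∈ S q, y v = ∑ v, A v * y v := by
      simp only [A, Finset.sum_mul, Finset.mul_sum]
      rw [Finset.sum_comm' (t' := Finset.univ) (s' := fun v => Q.filter (fun q => v ∈ S q))]
      intro q v; simp
    have h2 : ∑ v ∈ U, w v * y v = ∑ v, w v * y v := by
      refine Finset.sum_subset (Finset.subset_univ _) fun v _ hv => ?_
      simp [y, hv]
    simp only [f, mul_sub, Finset.sum_sub_distrib]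
    rw [h1, h2, sub_add, ← Finset.sum_sub_distrib, sub_eq_add_neg, ← Finset.sum_neg_distrib]
    congr 1
    refine Finset.sum_congr rfl fun v _ => ?_
    simp only [β, y]
    split_ifs
    · ring
    · ring

/-- Lemma 8 of the paper: existence of an optimal dual solution of the
partial-route LP with small total `α`-mass and nonpositive reduced coefficients at
customers of zero weight. -/
theorem statement_16
    (C : ℚ) (hC : 0 < C) (dxi : Vp → ℚ) (hd : ∀ v, 0 ≤ dxi v)
    (w : Vp → ℚ) (hw : ∀ v, 0 ≤ w v) (b : Vp → ℤ) (hb : ∀ v, 0 ≤ b v)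
    (Hs : List (Finset Vp)) (hH : IsPartialRoute Hs)
    (hfeas : {r : ℝ | ∃ y : Vp → ℝ, (∀ v, 0 ≤ y v ∧ y v ≤ (b v : ℝ)) ∧
        (∀ q ∈ segIdx Hs,
          (kxi C dxi (seg Hs q.1 q.2) : ℝ) - 1 ≤ ∑ v ∈ seg Hs q.1 q.2, y v) ∧
        r = ∑ v ∈ VplusH Hs, (w v : ℝ) * y v}.Nonempty) :
    ∃ (α : ℕ × ℕ → ℝ) (β : Vp → ℝ),
      (∀ q ∈ segIdx Hs, 0 ≤ α q) ∧ (∀ v, β v ≤ 0) ∧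
      (∀ v ∈ VplusH Hs,
        (∑ q ∈ (segIdx Hs).filter (fun q => v ∈ seg Hs q.1 q.2), α q) + β v ≤ (w v : ℝ)) ∧
      IsGreatest
        {r : ℝ | ∃ (α' : ℕ × ℕ → ℝ) (β' : Vp → ℝ),
            (∀ q ∈ segIdx Hs, 0 ≤ α' q) ∧ (∀ v, β' v ≤ 0) ∧
            (∀ v ∈ VplusH Hs,
              (∑ q ∈ (segIdx Hs).filter (fun q => v ∈ seg Hs q.1 q.2), α' q) + β' v
                ≤ (w v : ℝ)) ∧
            r = (∑ q ∈ segIdx Hs, α' q * ((kxi C dxi (seg Hs q.1 q.2) : ℝ) - 1))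
                + ∑ v, β' v * (b v : ℝ)}
        ((∑ q ∈ segIdx Hs, α q * ((kxi C dxi (seg Hs q.1 q.2) : ℝ) - 1))
          + ∑ v, β v * (b v : ℝ)) ∧
      (∑ q ∈ segIdx Hs, α q)
        ≤ sInf {r : ℝ | ∃ y : Vp → ℝ, (∀ v, 0 ≤ y v ∧ y v ≤ (b v : ℝ)) ∧
            (∀ q ∈ segIdx Hs,
              (kxi C dxi (seg Hs q.1 q.2) : ℝ) - 1 ≤ ∑ v ∈ seg Hs q.1 q.2, y v) ∧
            r = ∑ v ∈ VplusH Hs, (w v : ℝ) * y v} ∧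
      (∀ v, w v = 0 →
        (∑ q ∈ (segIdx Hs).filter (fun q => v ∈ seg Hs q.1 q.2), α q) + β v ≤ 0) := by
  classical
  have hmono : ∀ q ∈ segIdx Hs, seg Hs q.1 q.2 ⊆ VplusH Hs := by
    have hmem : ∀ (l : List (Finset Vp)) (v : Vp), v ∈ VplusH l ↔ ∃ S ∈ l, v ∈ S := by
      intro l v
      induction l with
      | nil => simp [VplusH]
      | cons S l ih =>
        have : VplusH (S :: l) = S ∪ VplusH l := rfl
        rw [this, Finset.mem_union, ih]; simp
    intro q _ v hv
    rw [seg, hmem] at hv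
    obtain ⟨S, hS, hvS⟩ := hv
    exact (hmem _ _).2 ⟨S, List.mem_of_mem_drop (List.mem_of_mem_take hS), hvS⟩
  have hw' : ∀ v, (0 : ℝ) ≤ (w v : ℝ) := fun v => by exact_mod_cast hw v
  set P := {r : ℝ | ∃ y : Vp → ℝ, (∀ v, 0 ≤ y v ∧ y v ≤ (b v : ℝ)) ∧
        (∀ q ∈ segIdx Hs,
          (kxi C dxi (seg Hs q.1 q.2) : ℝ) - 1 ≤ ∑ v ∈ seg Hs q.1 q.2, y v) ∧
        r = ∑ v ∈ VplusH Hs, (w v : ℝ) * y v} with hP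
  have hPn : ∀ r ∈ P, 0 ≤ r := by
    rintro r ⟨y, hy, -, rfl⟩
    exact Finset.sum_nonneg fun v _ => mul_nonneg (hw' v) (hy v).1
  obtain ⟨α, β, hα, hβ, hdual, hobj, hsum⟩ := core16 (segIdx Hs) (fun q => seg Hs q.1 q.2)
    (VplusH Hs) hmono (fun q => kxi C dxi (seg Hs q.1 q.2) - 1) (fun v => (w v : ℝ)) hw' b hb
    (sInf P) (Real.sInf_nonneg hPn) (by
      intro y hy hq
      refine csInf_le ⟨0, hPn⟩ ⟨y, hy, ?_, rfl⟩
      intro q hq1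
      have := hq q hq1
      push_cast at this
      exact this)
  push_cast at hobj
  refine ⟨α, β, hα, hβ, hdual, ⟨⟨α, β, hα, hβ, hdual, rfl⟩, ?_⟩, hsum, ?_⟩
  · rintro r ⟨α', β', hα', hβ', hd', rfl⟩
    refine le_trans (le_csInf hfeas ?_) hobj
    rintro r ⟨y, hy, hq, rfl⟩
    have h1 : ∑ q ∈ segIdx Hs, α' q * ((kxi C dxi (seg Hs q.1 q.2) : ℝ) - 1)
        ≤ ∑ q ∈ segIdx Hs, α' q * ∑ v ∈ seg Hs q.1 q.2, y v :=
      Finset.sum_le_sum fun q hq1 => mul_le_mul_of_nonneg_left (hq q hq1) (hα' q hq1)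
    have h2 : ∑ q ∈ segIdx Hs, α' q * ∑ v ∈ seg Hs q.1 q.2, y v
        = ∑ v ∈ VplusH Hs,
          (∑ q ∈ (segIdx Hs).filter (fun q => v ∈ seg Hs q.1 q.2), α' q) * y v := by
      simp only [Finset.sum_mul, Finset.mul_sum]
      rw [Finset.sum_comm' (t' := VplusH Hs)
        (s' := fun v => (segIdx Hs).filter (fun q => v ∈ seg Hs q.1 q.2))]
      intro q v
      simp only [Finset.mem_filter]
      constructor
      · rintro ⟨h, h'⟩; exact ⟨⟨h, h'⟩, hmono q h h'⟩
      · rintro ⟨h, -⟩; exact h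
    have h3 : ∑ v, β' v * (b v : ℝ) ≤ ∑ v ∈ VplusH Hs, β' v * y v := by
      calc ∑ v, β' v * (b v : ℝ) ≤ ∑ v ∈ VplusH Hs, β' v * (b v : ℝ) := by
            rw [← Finset.sum_add_sum_compl (VplusH Hs)]
            have : ∑ v ∈ (VplusH Hs)ᶜ, β' v * (b v : ℝ) ≤ 0 :=
              Finset.sum_nonpos fun v _ => mul_nonpos_of_nonpos_of_nonneg (hβ' v)
                (by exact_mod_cast hb v)
            linarith
        _ ≤ _ := Finset.sum_le_sum fun v _ => mul_le_mul_of_nonpos_left (hy v).2 (hβ' v)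
    have h4 : ∑ v ∈ VplusH Hs,
          (∑ q ∈ (segIdx Hs).filter (fun q => v ∈ seg Hs q.1 q.2), α' q) * y v
          + ∑ v ∈ VplusH Hs, β' v * y v ≤ ∑ v ∈ VplusH Hs, (w v : ℝ) * y v := by
      rw [← Finset.sum_add_distrib]
      refine Finset.sum_le_sum fun v hv => ?_
      rw [← add_mul]
      exact mul_le_mul_of_nonneg_right (hd' v hv) (hy v).1
    linarith
  · intro v hv
    by_cases hvU : v ∈ VplusH Hs
    · have := hdual v hvU
      simpa [hv] using this
    · rw [Finset.filter_false_of_mem fun q hq h => hvU (hmono q hq h)]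
      simpa using hβ v

end VRPSD
end

section
/- Let H be a partial route such that the LP defining L*_ξ(H) is feasible for every ξ ∈ [N]. Then there exist multipliers (α, β) ∈ 𝒜 such that the projected SRI, Σ_{v∈V₊ : w_v>0} φ_v(α,β)·θ_v ≥ Σ_{ξ∈[N]} Σ_{∅⊊S⊆V₊} α^ξ_S·x(E(S)) + ν(α,β), dominates the partial route cut θ(V₊(H)) ≥ L*(H)·W_OF(x; H): every (x,θ) ∈ 𝒳 × ℝ₊^{V₊} satisfying the projected SRI also satisfies the partial route cut. In particular, the partial route cut θ(V₊(H)) ≥ L*(H)·W_OF(x; H) is valid for 𝒫. -/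
set_option autoImplicit false

open Finset

namespace VRPSD

variable {Vp : Type*} [Fintype Vp] [DecidableEq Vp]
variable {Sc : Type*} [Fintype Sc] [Nonempty Sc]

/-- `L*_ξ(H)`: the optimal value of the partial-route LP for scenario demand `dxi`. -/
noncomputable def LstarH (C : ℚ) (dxi : Vp → ℚ) (w : Vp → ℚ) (b : Vp → ℤ)
    (Hs : List (Finset Vp)) : ℝ :=
  sInf {r : ℝ | ∃ y : Vp → ℝ, (∀ v, 0 ≤ y v ∧ y v ≤ (b v : ℝ)) ∧
      (∀ q ∈ segIdx Hs,
        (kxi C dxi (seg Hs q.1 q.2) : ℝ) - 1 ≤ ∑ v ∈ seg Hs q.1 q.2, y v) ∧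
      r = ∑ v ∈ VplusH Hs, (w v : ℝ) * y v}

lemma aux_primal (F : Finset (Finset Vp)) (K : Finset Vp → ℤ) (w : Vp → ℝ) (b : Vp → ℤ)
    (hw : ∀ v, 0 ≤ w v) (hb : ∀ v, 0 ≤ b v) (L : ℝ) (hL : 0 ≤ L)
    (hopt : ∀ y : Vp → ℝ, (∀ v, 0 ≤ y v ∧ y v ≤ (b v : ℝ)) →
      (∀ S ∈ F, (K S : ℝ) ≤ ∑ v ∈ S, y v) → L ≤ ∑ v, w v * y v)
    (y : Vp → ℝ) (hy : ∀ v, 0 ≤ y v ∧ y v ≤ (b v : ℝ)) (τ : ℝ) (hτ : 0 ≤ τ)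
    (hc : ∀ S ∈ F, (K S : ℝ) - τ ≤ ∑ v ∈ S, y v) :
    L * (1 - τ) ≤ ∑ v, w v * y v := by
  rcases le_or_gt 1 τ with h1 | h1
  · have h2 : 0 ≤ ∑ v, w v * y v := Finset.sum_nonneg fun v _ => mul_nonneg (hw v) (hy v).1
    nlinarith
  have hpos : 0 < 1 - τ := by linarith
  have hbr : ∀ v, (0:ℝ) ≤ b v := fun v => by exact_mod_cast hb v
  have key := hopt (fun v => min (b v : ℝ) (y v / (1 - τ)))
    (fun v => ⟨le_min (hbr v) (div_nonneg (hy v).1 hpos.le), min_le_left _ _⟩) ?_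
  · have h3 : ∑ v, w v * min (b v : ℝ) (y v / (1 - τ)) ≤ ∑ v, w v * (y v / (1 - τ)) :=
      Finset.sum_le_sum fun v _ => mul_le_mul_of_nonneg_left (min_le_right _ _) (hw v)
    have h4 : ∑ v, w v * (y v / (1 - τ)) = (∑ v, w v * y v) / (1 - τ) := by
      rw [Finset.sum_div]; exact Finset.sum_congr rfl fun v _ => by ring
    rw [h4] at h3
    exact (le_div_iff₀ hpos).1 (key.trans h3)
  · intro S hS
    set T := S.filter (fun v => (b v : ℝ) ≤ y v / (1 - τ)) with hT
    set R := S.filter (fun v => ¬ (b v : ℝ) ≤ y v / (1 - τ)) with hR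
    have e1 := Finset.sum_filter_add_sum_filter_not S (fun v => (b v : ℝ) ≤ y v / (1 - τ))
      (fun v => min (b v : ℝ) (y v / (1 - τ)))
    have e2 := Finset.sum_filter_add_sum_filter_not S (fun v => (b v : ℝ) ≤ y v / (1 - τ)) y
    rw [← hT, ← hR] at e1 e2
    have e3 : ∑ v ∈ T, min (b v : ℝ) (y v / (1 - τ)) = ((∑ v ∈ T, b v : ℤ) : ℝ) := by
      push_cast
      exact Finset.sum_congr rfl fun v hv => min_eq_left (Finset.mem_filter.1 hv).2
    have e4 : ∑ v ∈ R, min (b v : ℝ) (y v / (1 - τ)) = (∑ v ∈ R, y v) / (1 - τ) := by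
      rw [Finset.sum_div]
      exact Finset.sum_congr rfl fun v hv =>
        min_eq_right (le_of_not_ge (Finset.mem_filter.1 hv).2)
    have e5 : ∑ v ∈ T, y v ≤ ((∑ v ∈ T, b v : ℤ) : ℝ) := by
      push_cast
      exact Finset.sum_le_sum fun v _ => (hy v).2
    have e6 : 0 ≤ ∑ v ∈ R, y v := Finset.sum_nonneg fun v _ => (hy v).1
    have hcS := hc S hS
    rw [← e1, e3, e4]
    generalize (∑ v ∈ T, b v) = B at *
    rcases le_or_gt (K S) B with h | h
    · have : (K S : ℝ) ≤ B := by exact_mod_cast h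
      have : 0 ≤ (∑ v ∈ R, y v) / (1 - τ) := div_nonneg e6 hpos.le
      linarith
    · have h' : (B : ℝ) + 1 ≤ K S := by exact_mod_cast h
      have : (K S : ℝ) - B ≤ (∑ v ∈ R, y v) / (1 - τ) := by
        rw [le_div_iff₀ hpos]
        nlinarith
      linarith

lemma aux_dual (F : Finset (Finset Vp)) (K : Finset Vp → ℤ) (w : Vp → ℝ) (b : Vp → ℤ)
    (hw : ∀ v, 0 ≤ w v) (hb : ∀ v, 0 ≤ b v) (L : ℝ) (hL : 0 ≤ L)
    (hopt : ∀ y : Vp → ℝ, (∀ v, 0 ≤ y v ∧ y v ≤ (b v : ℝ)) →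
      (∀ S ∈ F, (K S : ℝ) ≤ ∑ v ∈ S, y v) → L ≤ ∑ v, w v * y v) :
    ∃ (α : Finset Vp → ℝ) (β : Vp → ℝ), (∀ S, 0 ≤ α S) ∧ (∀ S, S ∉ F → α S = 0) ∧
      (∑ S, α S ≤ L) ∧ (∀ v, β v ≤ 0) ∧
      (∀ v, β v + ∑ S ∈ univ.filter (fun S : Finset Vp => v ∈ S), α S ≤ w v) ∧
      L ≤ ∑ S, α S * (K S : ℝ) + ∑ v, β v * (b v : ℝ) := by
  classical
  have hbr : ∀ v, (0:ℝ) ≤ b v := fun v => by exact_mod_cast hb v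
  let Y : Set (Vp → ℝ) := Set.Icc 0 (fun v => (b v : ℝ))
  let A : Set (Finset Vp → ℝ) :=
    Set.Icc 0 (fun S => if S ∈ F then L else 0) ∩ {a | ∑ S, a S ≤ L}
  let f : (Vp → ℝ) → (Finset Vp → ℝ) → ℝ := fun y a =>
    ∑ v, w v * y v + ∑ S, a S * ((K S : ℝ) - ∑ v ∈ S, y v)
  have hYne : Y.Nonempty := ⟨0, ⟨le_rfl, fun v => hbr v⟩⟩
  have hA0 : (0 : Finset Vp → ℝ) ∈ A := by
    refine ⟨⟨le_rfl, fun S => ?_⟩, ?_⟩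
    · simp only [Pi.zero_apply]; split_ifs <;> simp [hL]
    · simpa using hL
  have hYc : Convex ℝ Y := convex_Icc _ _
  have hAc : Convex ℝ A := by
    refine (convex_Icc _ _).inter ?_
    intro a ha c hc s t hs ht hst
    simp only [Set.mem_ofPred_eq, Pi.add_apply, Pi.smul_apply, smul_eq_mul,
      Finset.sum_add_distrib, ← Finset.mul_sum] at *
    calc _ ≤ s * L + t * L := by gcongr
      _ = L := by rw [← add_mul, hst, one_mul]
  have hYk : IsCompact Y := isCompact_Icc
  have hAk : IsCompact A := by
    refine isCompact_Icc.inter_right ?_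
    exact isClosed_le (by fun_prop) continuous_const
  have hcomb1 : ∀ (a : Finset Vp → ℝ) (y z : Vp → ℝ) (s t : ℝ), s + t = 1 →
      f (s • y + t • z) a = s * f y a + t * f z a := by
    intro a y z s t hst
    have ht : t = 1 - s := by linarith
    subst ht
    simp only [f, Pi.add_apply, Pi.smul_apply, smul_eq_mul, Finset.sum_add_distrib, mul_add,
      mul_sub, Finset.sum_sub_distrib, Finset.mul_sum]
    have q1 : ∀ (c : ℝ), ∑ S, ∑ v ∈ S, a S * (c * y v) = ∑ S, ∑ v ∈ S, c * (a S * y v) :=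
      fun c => Finset.sum_congr rfl fun S _ => Finset.sum_congr rfl fun v _ => by ring
    have q2 : ∀ (c : ℝ), ∑ S, ∑ v ∈ S, a S * (c * z v) = ∑ S, ∑ v ∈ S, c * (a S * z v) :=
      fun c => Finset.sum_congr rfl fun S _ => Finset.sum_congr rfl fun v _ => by ring
    have q3 : ∀ (c : ℝ), ∑ v, w v * (c * y v) = ∑ v, c * (w v * y v) :=
      fun c => Finset.sum_congr rfl fun v _ => by ring
    have q4 : ∀ (c : ℝ), ∑ v, w v * (c * z v) = ∑ v, c * (w v * z v) :=
      fun c => Finset.sum_congr rfl fun v _ => by ring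
    rw [q1, q2, q3, q4]
    simp only [← Finset.mul_sum]
    ring
  have hcomb2 : ∀ (y : Vp → ℝ) (a c : Finset Vp → ℝ) (s t : ℝ), s + t = 1 →
      f y (s • a + t • c) = s * f y a + t * f y c := by
    intro y a c s t hst
    have ht : t = 1 - s := by linarith
    subst ht
    simp only [f, Pi.add_apply, Pi.smul_apply, smul_eq_mul, Finset.sum_add_distrib, add_mul,
      mul_assoc, ← Finset.mul_sum]
    ring
  obtain ⟨y0, hy0, a0, ha0, hsad⟩ : ∃ y ∈ Y, ∃ a ∈ A, IsSaddlePointOn Y A f y a := by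
    have c1 : ∀ a ∈ A, LowerSemicontinuousOn (fun y => f y a) Y := fun a _ => by
      have : Continuous (fun y => f y a) := by fun_prop
      exact this.lowerSemicontinuous.lowerSemicontinuousOn _
    have c2 : ∀ y ∈ Y, UpperSemicontinuousOn (fun a => f y a) A := fun y _ => by
      have : Continuous (fun a => f y a) := by fun_prop
      exact this.upperSemicontinuous.upperSemicontinuousOn _
    have c3 : ∀ a ∈ A, QuasiconvexOn ℝ Y (fun y => f y a) := fun a _ => by
      refine ConvexOn.quasiconvexOn ⟨hYc, ?_⟩
      intro y _ z _ s t _ _ hst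
      simp only [hcomb1 a y z s t hst, smul_eq_mul, le_refl]
    have c4 : ∀ y ∈ Y, QuasiconcaveOn ℝ A (fun a => f y a) := fun y _ => by
      refine ConcaveOn.quasiconcaveOn ⟨hAc, ?_⟩
      intro a _ c _ s t _ _ hst
      simp only [hcomb2 y a c s t hst, smul_eq_mul, le_refl]
    exact Sion.exists_isSaddlePointOn' hYne hYk c1 c3 hAc hAk c2 c4 hYc ⟨0, hA0⟩
  have hval : ∀ y ∈ Y, L ≤ f y a0 := by
    intro y hy
    suffices h : ∃ a ∈ A, L ≤ f y0 a by
      obtain ⟨a, ha, h⟩ := h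
      exact h.trans (hsad y hy a ha)
    have hy0' : ∀ v, 0 ≤ y0 v ∧ y0 v ≤ (b v : ℝ) := fun v => ⟨hy0.1 v, hy0.2 v⟩
    by_cases hall : ∀ S ∈ F, (K S : ℝ) ≤ ∑ v ∈ S, y0 v
    · refine ⟨0, hA0, ?_⟩
      simpa [f] using hopt y0 hy0' hall
    · push Not at hall
      obtain ⟨S1, hS1, hlt⟩ := hall
      obtain ⟨S, hS, hmax⟩ := F.exists_max_image (fun S => (K S : ℝ) - ∑ v ∈ S, y0 v) ⟨S1, hS1⟩
      refine ⟨Pi.single S L, ⟨⟨?_, ?_⟩, ?_⟩, ?_⟩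
      · intro T
        by_cases h : T = S
        · subst h; simpa using hL
        · simp [h]
      · intro T
        by_cases h : T = S
        · subst h; simp [hS]
        · simp only [Pi.single_apply, h, if_false]; split_ifs <;> simp [hL]
      · simp
      · have h0 := hmax S1 hS1
        have := aux_primal F K w b hw hb L hL hopt y0 hy0'
          ((K S : ℝ) - ∑ v ∈ S, y0 v) (by linarith) (by
            intro T hT
            have := hmax T hT
            linarith)
        simp only [f, Pi.single_apply, ite_mul, zero_mul, Finset.sum_ite_eq', Finset.mem_univ,
          if_true]
        linarith
  have ha0' : ∀ S, 0 ≤ a0 S := fun S => ha0.1.1 S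
  set D : Vp → ℝ := fun v => ∑ S ∈ univ.filter (fun S : Finset Vp => v ∈ S), a0 S with hD
  have hswap : ∀ y : Vp → ℝ, ∑ S, a0 S * ∑ v ∈ S, y v = ∑ v, D v * y v := by
    intro y
    simp only [hD, Finset.mul_sum, Finset.sum_mul, Finset.sum_filter]
    rw [Finset.sum_comm' (t' := univ) (s' := fun v => univ.filter (fun S : Finset Vp => v ∈ S))
      (by simp)]
    refine Finset.sum_congr rfl fun v _ => ?_
    rw [Finset.sum_filter]
    exact Finset.sum_congr rfl fun S _ => by split_ifs <;> simp
  refine ⟨a0, fun v => min 0 (w v - D v), ha0', ?_, ha0.2, fun v => min_le_left _ _, ?_, ?_⟩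
  · intro S hS
    have h1 := ha0.1.2 S
    simp only [hS, if_false] at h1
    exact le_antisymm h1 (ha0' S)
  · intro v
    have := min_le_right 0 (w v - D v)
    change min 0 (w v - D v) + D v ≤ w v
    linarith
  · have h := hval (fun v => if w v - D v ≤ 0 then (b v : ℝ) else 0)
      ⟨fun v => by simp only [Pi.zero_apply]; split_ifs <;> simp [hbr],
       fun v => by simp only; split_ifs <;> simp [hbr]⟩
    simp only [f, mul_sub, Finset.sum_sub_distrib, hswap] at h
    have e : ∑ v, min 0 (w v - D v) * (b v : ℝ)
        = ∑ v, w v * (if w v - D v ≤ 0 then (b v : ℝ) else 0)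
          - ∑ v, D v * (if w v - D v ≤ 0 then (b v : ℝ) else 0) := by
      rw [← Finset.sum_sub_distrib]
      refine Finset.sum_congr rfl fun v _ => ?_
      split_ifs with h1
      · rw [min_eq_right h1]; ring
      · rw [min_eq_left (le_of_not_ge h1)]; ring
    rw [e]
    linarith

lemma aux_inSum_eq (x : Option Vp → Option Vp → ℝ) (h : ∀ u, x u u = 0) (S : Finset Vp) :
    inSum x S = (1/2) * ∑ u ∈ S, ∑ v ∈ S, x (some u) (some v) := by
  unfold inSum
  congr 1
  refine Finset.sum_congr rfl fun u _ => ?_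
  rw [Finset.sum_filter]
  refine Finset.sum_congr rfl fun v _ => ?_
  split_ifs with h1
  · rfl
  · push Not at h1
    rw [h1, h]

lemma aux_cross_comm (x : Option Vp → Option Vp → ℝ) (hs : ∀ u v, x u v = x v u)
    (S T : Finset Vp) : crossSum x S T = crossSum x T S := by
  unfold crossSum
  rw [Finset.sum_comm]
  exact Finset.sum_congr rfl fun u _ => Finset.sum_congr rfl fun v _ => hs _ _

lemma aux_inSum_union (x : Option Vp → Option Vp → ℝ) (h : ∀ u, x u u = 0)
    (hs : ∀ u v, x u v = x v u) (S T : Finset Vp) (hd : Disjoint S T) :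
    inSum x (S ∪ T) = inSum x S + inSum x T + crossSum x S T := by
  have hc := aux_cross_comm x hs S T
  rw [aux_inSum_eq x h, aux_inSum_eq x h, aux_inSum_eq x h]
  unfold crossSum at *
  simp only [Finset.sum_union hd, Finset.sum_add_distrib]
  rw [← hc]
  ring

/-- slack of a customer set -/
noncomputable def slk (x : Option Vp → Option Vp → ℝ) (S : Finset Vp) : ℝ :=
  (S.card : ℝ) - 1 - inSum x S

/-- slack of a partial route -/
noncomputable def sg (x : Option Vp → Option Vp → ℝ) (L : List (Finset Vp)) : ℝ :=
  (L.map (fun S => (S.card : ℝ))).sum - 1 - xH x L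

lemma sg_single (x : Option Vp → Option Vp → ℝ) (S : Finset Vp) : sg x [S] = slk x S := by
  simp [sg, slk, xH]

lemma sg_cons (x : Option Vp → Option Vp → ℝ) (S T : Finset Vp) (L : List (Finset Vp)) :
    sg x (S :: T :: L) = slk x S + sg x (T :: L) + 1 - crossSum x S T := by
  simp [sg, slk, xH]
  ring

lemma sg_append (x : Option Vp → Option Vp → ℝ) (A B : List (Finset Vp)) (T S : Finset Vp) :
    sg x (A ++ T :: S :: B) = sg x (A ++ [T]) + sg x (S :: B) + 1 - crossSum x T S := by
  induction A with
  | nil => simp only [List.nil_append]; rw [sg_cons, sg_single]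
  | cons a A ih =>
    cases A with
    | nil =>
      simp only [List.nil_append, List.cons_append] at *
      rw [sg_cons, sg_cons x a T, ih]; ring
    | cons c A =>
      simp only [List.cons_append] at *
      rw [sg_cons, sg_cons x a c (A ++ [T]), ih]; ring

lemma sg_reverse (x : Option Vp → Option Vp → ℝ) (hs : ∀ u v, x u v = x v u)
    (L : List (Finset Vp)) : sg x L.reverse = sg x L := by
  induction L with
  | nil => rfl
  | cons S L ih =>
    cases L with
    | nil => rfl
    | cons T L =>
      rw [List.reverse_cons, List.reverse_cons, List.append_assoc, List.singleton_append,
        sg_append, sg_single, ← List.reverse_cons, ih, sg_cons, aux_cross_comm x hs T S]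
      ring

lemma aux_disj_Vplus (S : Finset Vp) (L : List (Finset Vp)) (h : ∀ T ∈ L, Disjoint S T) :
    Disjoint S (VplusH L) := by
  induction L with
  | nil => simp [VplusH]
  | cons T L ih =>
    have : VplusH (T :: L) = T ∪ VplusH L := rfl
    rw [this, Finset.disjoint_union_right]
    exact ⟨h T (by simp), ih fun T hT => h T (by simp [hT])⟩

lemma aux_card (L : List (Finset Vp)) (h : L.Pairwise Disjoint) :
    (L.map (fun S => (S.card : ℝ))).sum = ((VplusH L).card : ℝ) := by
  induction L with
  | nil => simp [VplusH]
  | cons S L ih =>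
    rw [List.pairwise_cons] at h
    have : VplusH (S :: L) = S ∪ VplusH L := rfl
    rw [this, Finset.card_union_of_disjoint (aux_disj_Vplus S L h.1)]
    simp [ih h.2]

lemma aux_xnonneg {x : Option Vp → Option Vp → ℝ} (hx : x ∈ Xsub) (u v) : 0 ≤ x u v := by
  by_cases h : u = v
  · rw [h, hx.2.1]
  · exact (hx.2.2.1 u v h).1

lemma aux_xH_le {x : Option Vp → Option Vp → ℝ} (hx : x ∈ Xsub) (L : List (Finset Vp))
    (h : L.Pairwise Disjoint) : xH x L ≤ inSum x (VplusH L) := by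
  induction L with
  | nil => simp [xH, VplusH, inSum]
  | cons S L ih =>
    rw [List.pairwise_cons] at h
    have e : VplusH (S :: L) = S ∪ VplusH L := rfl
    have ih' := ih h.2
    rw [e, aux_inSum_union x hx.2.1 hx.1 _ _ (aux_disj_Vplus S L h.1)]
    cases L with
    | nil => simp [xH, VplusH, inSum, crossSum]
    | cons T L =>
      have h1 : xH x (S :: T :: L) = inSum x S + xH x (T :: L) + crossSum x S T := by
        simp [xH]; ring
      have h2 : crossSum x S T ≤ crossSum x S (VplusH (T :: L)) := by
        unfold crossSum
        refine Finset.sum_le_sum fun u _ => ?_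
        refine Finset.sum_le_sum_of_subset_of_nonneg Finset.subset_union_left ?_
        intros; exact aux_xnonneg hx _ _
      linarith

lemma aux_slk_le {x : Option Vp → Option Vp → ℝ} (hx : x ∈ Xsub) (L : List (Finset Vp))
    (h : L.Pairwise Disjoint) : slk x (VplusH L) ≤ sg x L := by
  have := aux_xH_le hx L h
  unfold slk sg
  rw [aux_card L h]
  linarith

lemma aux_slk_nonneg {x : Option Vp → Option Vp → ℝ} (hx : x ∈ Xsub) (S : Finset Vp)
    (h : S.Nonempty) : 0 ≤ slk x S := by
  have := hx.2.2.2.2 S h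
  unfold slk
  linarith

lemma aux_Vplus_ne (L : List (Finset Vp)) (h0 : L ≠ []) (h : ∀ S ∈ L, S.Nonempty) :
    (VplusH L).Nonempty := by
  cases L with
  | nil => exact absurd rfl h0
  | cons S L => exact (h S (by simp)).mono Finset.subset_union_left

lemma aux_sg_nonneg {x : Option Vp → Option Vp → ℝ} (hx : x ∈ Xsub) (L : List (Finset Vp))
    (h0 : L ≠ []) (hne : ∀ S ∈ L, S.Nonempty)
    (h : L.Pairwise Disjoint) : 0 ≤ sg x L :=
  (aux_slk_nonneg hx _ (aux_Vplus_ne L h0 hne)).trans (aux_slk_le hx L h)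

lemma aux_slk_one {x : Option Vp → Option Vp → ℝ} (hx : x ∈ Xsub) (S : Finset Vp)
    (h : S.card = 1) : slk x S = 0 := by
  obtain ⟨v, rfl⟩ := Finset.card_eq_one.1 h
  unfold slk
  rw [aux_inSum_eq x hx.2.1]
  simp [hx.2.1]

lemma aux_deg {x : Option Vp → Option Vp → ℝ} (hx : x ∈ Xsub) (T S : Finset Vp) (v : Vp)
    (hTS : Disjoint T S) (hT : v ∉ T) (hS : v ∉ S) :
    crossSum x T {v} + crossSum x {v} S ≤ 2 := by
  rw [aux_cross_comm x hx.1 {v} S, ← hx.2.2.2.1 v]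
  unfold crossSum degCust
  simp only [Finset.sum_singleton]
  rw [← Finset.sum_union hTS]
  have := Finset.sum_map (T ∪ S) Function.Embedding.some (fun u => x u (some v))
  simp only [Function.Embedding.some_apply] at this
  rw [← this]
  refine Finset.sum_le_sum_of_subset_of_nonneg ?_ fun _ _ _ => aux_xnonneg hx _ _
  intro u hu
  simp only [Finset.mem_map, Finset.mem_union, Function.Embedding.some_apply] at hu
  obtain ⟨a, ha, rfl⟩ := hu
  simp only [Finset.mem_filter, Finset.mem_univ, true_and, ne_eq, Option.some.injEq]
  rintro rfl
  exact ha.elim hT hS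

/-- A (possibly empty) tuple satisfying the partial route conditions. -/
def PR (L : List (Finset Vp)) : Prop :=
  (∀ S ∈ L, S.Nonempty) ∧ L.Pairwise Disjoint ∧
  L.IsChain (fun S T => S.card = 1 ∨ T.card = 1)

lemma PR.left {A B : List (Finset Vp)} (h : PR (A ++ B)) : PR A :=
  ⟨fun S hS => h.1 S (by simp [hS]), (List.pairwise_append.1 h.2.1).1, h.2.2.left_of_append⟩

lemma PR.right {A B : List (Finset Vp)} (h : PR (A ++ B)) : PR B :=
  ⟨fun S hS => h.1 S (by simp [hS]), (List.pairwise_append.1 h.2.1).2.1, h.2.2.right_of_append⟩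

lemma PR.reverse {A : List (Finset Vp)} (h : PR A) : PR A.reverse := by
  refine ⟨fun S hS => h.1 S (by simpa using hS), ?_, ?_⟩
  · rw [List.pairwise_reverse]
    exact h.2.1.imp fun h => h.symm
  · rw [List.isChain_reverse]
    exact h.2.2.imp fun _ _ h => h.symm

lemma aux_left1 {x : Option Vp → Option Vp → ℝ} (hx : x ∈ Xsub) (T S : Finset Vp)
    (M : List (Finset Vp)) (h : PR (T :: S :: M)) :
    sg x (S :: M) ≤ sg x (T :: S :: M) + slk x S := by
  have h2 : PR [T, S] := PR.left (A := [T, S]) (B := M) h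
  have := aux_sg_nonneg hx [T, S] (by simp) h2.1 h2.2.1
  rw [sg_cons, sg_single] at this
  rw [sg_cons]
  linarith

lemma aux_left2 {x : Option Vp → Option Vp → ℝ} (hx : x ∈ Xsub) (A : List (Finset Vp))
    (T1 T2 S : Finset Vp) (M : List (Finset Vp)) (h : PR (A ++ T1 :: T2 :: S :: M)) :
    sg x (S :: M) ≤ sg x (A ++ T1 :: T2 :: S :: M) := by
  have hr : PR (T1 :: T2 :: S :: M) := h.right
  have hl : PR (A ++ [T1]) := by
    have : A ++ T1 :: T2 :: S :: M = (A ++ [T1]) ++ (T2 :: S :: M) := by simp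
    rw [this] at h; exact h.left
  have hls : PR (A ++ [T1, T2, S]) := by
    have : A ++ T1 :: T2 :: S :: M = (A ++ [T1, T2, S]) ++ M := by simp
    rw [this] at h; exact h.left
  have hc : T2.card = 1 ∨ S.card = 1 := by
    have := hr.2.2
    simp only [List.isChain_cons_cons] at this
    exact this.2.1
  have n1 := aux_sg_nonneg hx _ (by simp) hl.1 hl.2.1
  have n2 := aux_sg_nonneg hx _ (by simp) hls.1 hls.2.1
  rw [sg_append, sg_cons] at n2 ⊢
  rw [sg_single] at n2
  rcases hc with hc | hc
  · have hz := aux_slk_one hx T2 hc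
    obtain ⟨v, rfl⟩ := Finset.card_eq_one.1 hc
    have hp := hr.2.1
    simp only [List.pairwise_cons, List.mem_cons, forall_eq_or_imp] at hp
    have := aux_deg hx T1 S v hp.1.2.1 (by simpa using hp.1.1) (by simpa using hp.2.1.1)
    linarith
  · have hz := aux_slk_one hx S hc
    linarith

lemma aux_left {x : Option Vp → Option Vp → ℝ} (hx : x ∈ Xsub) (A : List (Finset Vp))
    (S : Finset Vp) (M : List (Finset Vp)) (h : PR (A ++ S :: M)) :
    sg x (S :: M) ≤ sg x (A ++ S :: M) + (if A.length = 1 then slk x S else 0) := by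
  rcases List.eq_nil_or_concat A with rfl | ⟨A', T2, rfl⟩
  · simp
  rcases List.eq_nil_or_concat A' with rfl | ⟨A', T1, rfl⟩
  · simpa using aux_left1 hx T2 S M (by simpa using h)
  · simpa using aux_left2 hx A' T1 T2 S M (by simpa using h)

lemma aux_right {x : Option Vp → Option Vp → ℝ} (hx : x ∈ Xsub) (B : List (Finset Vp))
    (S : Finset Vp) (M : List (Finset Vp)) (h : PR (M ++ [S] ++ B)) :
    sg x (M ++ [S]) ≤ sg x (M ++ [S] ++ B) + (if B.length = 1 then slk x S else 0) := by
  have := aux_left hx B.reverse S M.reverse (by simpa using h.reverse)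
  have e1 : S :: M.reverse = (M ++ [S]).reverse := by simp
  have e2 : B.reverse ++ S :: M.reverse = (M ++ [S] ++ B).reverse := by simp
  rw [e2, e1, sg_reverse x hx.1, sg_reverse x hx.1] at this
  simpa using this

lemma aux_seg {x : Option Vp → Option Vp → ℝ} (hx : x ∈ Xsub) (A M B : List (Finset Vp))
    (hM : M ≠ []) (h : PR (A ++ M ++ B)) :
    slk x (VplusH M) ≤ 1 - WOF x (A ++ M ++ B) := by
  have hMd : PR M := h.left.right
  refine (aux_slk_le hx M hMd.2.1).trans ?_
  set H := A ++ M ++ B with hH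
  set I := ({2, H.length - 1} : Finset ℕ) ∩ Finset.Icc 1 H.length with hI
  have hW : 1 - WOF x H = sg x H + ∑ i ∈ I, slk x (H.getD (i-1) ∅) := by
    unfold WOF sg slk
    rw [aux_card H h.2.1]
    have : ∑ i ∈ I, (((H.getD (i-1) ∅).card : ℝ) - 1 - inSum x (H.getD (i-1) ∅))
      = - ∑ i ∈ I, (inSum x (H.getD (i-1) ∅) - ((H.getD (i-1) ∅).card : ℝ) + 1) := by
      rw [← Finset.sum_neg_distrib]
      exact Finset.sum_congr rfl fun i _ => by ring
    rw [this]; ring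
  rw [hW]
  have hnn : ∀ i ∈ I, 0 ≤ slk x (H.getD (i-1) ∅) := by
    intro i hi
    have hi2 := Finset.mem_Icc.1 (Finset.mem_inter.1 hi).2
    have hlt : i - 1 < H.length := by omega
    rw [List.getD_eq_getElem _ _ hlt]
    exact aux_slk_nonneg hx _ (h.1 _ (List.getElem_mem hlt))
  have hHpos := aux_sg_nonneg hx H (by simp [hH, hM]) h.1 h.2.1
  have hsum := Finset.sum_nonneg hnn
  have hsingle : ∀ i ∈ I, slk x (H.getD (i-1) ∅) ≤ ∑ i ∈ I, slk x (H.getD (i-1) ∅) :=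
    fun i hi => Finset.single_le_sum hnn hi
  obtain ⟨S, M1, hS⟩ := List.exists_cons_of_ne_nil hM
  obtain ⟨M2, S', hS'⟩ : ∃ M2 S', M = M2 ++ [S'] := by
    rcases List.eq_nil_or_concat M with h | ⟨a, c, h⟩
    · exact absurd h hM
    · exact ⟨a, c, by simpa using h⟩
  have l1 : sg x (M ++ B) ≤ sg x H + (if A.length = 1 then slk x S else 0) := by
    have := aux_left hx A S (M1 ++ B) (by rw [hH, hS] at h; simpa using h)
    have e : A ++ S :: (M1 ++ B) = H := by rw [hH, hS]; simp
    rw [e] at this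
    rw [hS]; simpa using this
  have l2 : sg x M ≤ sg x (M ++ B) + (if B.length = 1 then slk x S' else 0) := by
    have := aux_right hx B S' M2 (by
      rw [hH, List.append_assoc, hS'] at h; exact h.right)
    rw [hS']; exact this
  have lenH : H.length = A.length + M.length + B.length := by simp [hH]; omega
  have lenM : 0 < M.length := List.length_pos_iff.2 hM
  have gS : A.length = 1 → slk x S = slk x (H.getD (2-1) ∅) := by
    intro hA
    congr 1
    rw [hH, hS, List.append_assoc, List.getD_append_right _ _ _ _ (by omega)]
    simp [hA]
  have gS' : B.length = 1 → slk x S' = slk x (H.getD (H.length-1-1) ∅) := by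
    intro hB
    congr 1
    have e : H = (A ++ M2) ++ ([S'] ++ B) := by rw [hH, hS']; simp
    have e2 : H.length - 1 - 1 = (A ++ M2).length := by rw [e]; simp [hB]
    rw [e2, e, List.getD_append_right _ _ _ _ (by omega)]
    simp
  by_cases hA : A.length = 1
  · have m2 : 2 ∈ I := by simp [hI]; omega
    by_cases hB : B.length = 1
    · by_cases hM1 : M.length = 1
      · have : M1 = [] := by
          rw [hS] at hM1; simpa using hM1
        rw [this] at hS
        rw [hS, sg_single, gS hA]
        linarith [hsingle 2 m2]
      · have m3 : H.length - 1 ∈ I := by simp [hI]; omega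
        have hsub : ({2, H.length - 1} : Finset ℕ) ⊆ I := by
          intro i hi
          simp only [Finset.mem_insert, Finset.mem_singleton] at hi
          rcases hi with rfl | rfl
          · exact m2
          · exact m3
        have := Finset.sum_le_sum_of_subset_of_nonneg
          (f := fun i => slk x (H.getD (i-1) ∅)) hsub (fun i hi _ => hnn i hi)
        rw [Finset.sum_pair (by omega)] at this
        rw [if_pos hA, gS hA] at l1
        rw [if_pos hB, gS' hB] at l2
        linarith
    · rw [if_pos hA, gS hA] at l1
      rw [if_neg hB] at l2
      linarith [hsingle 2 m2]
  · rw [if_neg hA] at l1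
    by_cases hB : B.length = 1
    · rw [if_pos hB, gS' hB] at l2
      by_cases h3 : 2 ≤ H.length
      · have m3 : H.length - 1 ∈ I := by simp [hI]; omega
        linarith [hsingle _ m3]
      · omega
    · rw [if_neg hB] at l2
      linarith

lemma aux_seg' {x : Option Vp → Option Vp → ℝ} (hx : x ∈ Xsub) (Hs : List (Finset Vp))
    (h : IsPartialRoute Hs) (q : ℕ × ℕ) (hq : q ∈ segIdx Hs) :
    (seg Hs q.1 q.2).Nonempty ∧ slk x (seg Hs q.1 q.2) ≤ 1 - WOF x Hs := by
  simp only [segIdx, Finset.mem_filter, Finset.mem_product, Finset.mem_range] at hq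
  have hPR : PR Hs := ⟨h.2.1, h.2.2.1, h.2.2.2⟩
  have hne : (Hs.drop q.1).take (q.2 + 1 - q.1) ≠ [] := by
    rw [← List.length_pos_iff]
    simp
    omega
  have e : Hs = Hs.take q.1 ++ (Hs.drop q.1).take (q.2 + 1 - q.1)
      ++ (Hs.drop q.1).drop (q.2 + 1 - q.1) := by
    rw [List.append_assoc, List.take_append_drop, List.take_append_drop]
  have hPR2 := hPR
  rw [e] at hPR2
  refine ⟨aux_Vplus_ne _ hne hPR2.left.right.1, ?_⟩
  have := aux_seg hx _ _ _ hne hPR2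
  rw [← e] at this
  exact this

/-- Theorem 4 of the paper: there exist multipliers `(α,β) ∈ 𝒜` whose
projected SRI dominates the partial route cut `θ(V₊(H)) ≥ L*(H)·W_OF(x;H)`;
in particular the partial route cut is valid for `𝒫`. -/
theorem statement_17
    (C : ℚ) (hC : 0 < C) (d : Sc → Vp → ℚ)
    (hd : ∀ ξ v, 0 ≤ d ξ v) (hdC : ∀ ξ v, d ξ v ≤ C)
    (p : Sc → ℚ) (hp : ∀ ξ, 0 < p ξ) (hps : ∑ ξ, p ξ = 1)
    (k : ℕ) (hk : 0 < k)
    (X : Set (Option Vp → Option Vp → ℝ)) (hX : X = Xsub ∨ X = Xcvrp C p d k)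
    (w : Vp → ℚ) (hw : ∀ v, 0 ≤ w v) (b : Vp → ℤ) (hb : ∀ v, 0 ≤ b v)
    (Hs : List (Finset Vp)) (hH : IsPartialRoute Hs)
    (hfeas : ∀ ξ : Sc, {r : ℝ | ∃ y : Vp → ℝ, (∀ v, 0 ≤ y v ∧ y v ≤ (b v : ℝ)) ∧
        (∀ q ∈ segIdx Hs,
          (kxi C (d ξ) (seg Hs q.1 q.2) : ℝ) - 1 ≤ ∑ v ∈ seg Hs q.1 q.2, y v) ∧
        r = ∑ v ∈ VplusH Hs, (w v : ℝ) * y v}.Nonempty) :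
    ∃ (α : Sc → Finset Vp → ℝ) (β : Sc → Vp → ℝ), multA w α β ∧
      (∀ (x : Option Vp → Option Vp → ℝ) (θ : Vp → ℝ), x ∈ X → (∀ v, 0 ≤ θ v) →
        ((∑ ξ, ∑ S ∈ univ.filter (fun S : Finset Vp => S ≠ ∅), α ξ S * inSum x S)
            + nu C d b α β
          ≤ ∑ v ∈ univ.filter (fun v => 0 < w v), phiv p w α β v * θ v) →
        (∑ ξ, (p ξ : ℝ) * LstarH C (d ξ) w b Hs) * WOF x Hs ≤ ∑ v ∈ VplusH Hs, θ v) ∧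
      (∀ xθ ∈ Pset X C d p w b,
        (∑ ξ, (p ξ : ℝ) * LstarH C (d ξ) w b Hs) * WOF xθ.1 Hs
          ≤ ∑ v ∈ VplusH Hs, xθ.2 v) := by
  classical
  have hXsub : ∀ x ∈ X, x ∈ (Xsub : Set (Option Vp → Option Vp → ℝ)) := by
    rcases hX with h | h
    · intro x hx; rwa [h] at hx
    · intro x hx; rw [h] at hx; exact hx.1
  set F : Finset (Finset Vp) := (segIdx Hs).image (fun q => seg Hs q.1 q.2) with hF
  set w' : Vp → ℝ := fun v => if v ∈ VplusH Hs then (w v : ℝ) else 0 with hw'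
  have hwr : ∀ v, (0:ℝ) ≤ w v := fun v => by exact_mod_cast hw v
  have hpr : ∀ ξ, (0:ℝ) < p ξ := fun ξ => by exact_mod_cast hp ξ
  have hw'0 : ∀ v, 0 ≤ w' v := fun v => by
    simp only [hw']; split_ifs <;> simp [hwr]
  have hw'le : ∀ v, w' v ≤ w v := fun v => by
    simp only [hw']; split_ifs <;> simp [hwr]
  have hw's : ∀ y : Vp → ℝ, ∑ v, w' v * y v = ∑ v ∈ VplusH Hs, (w v : ℝ) * y v := by
    intro y
    simp only [hw', ite_mul, zero_mul, Finset.sum_ite_mem, Finset.univ_inter]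
  have hL0 : ∀ ξ, 0 ≤ LstarH C (d ξ) w b Hs := by
    intro ξ
    refine Real.sInf_nonneg ?_
    rintro r ⟨y, hy, _, rfl⟩
    exact Finset.sum_nonneg fun v _ => mul_nonneg (hwr v) (hy v).1
  have hopt : ∀ ξ, ∀ y : Vp → ℝ, (∀ v, 0 ≤ y v ∧ y v ≤ (b v : ℝ)) →
      (∀ S ∈ F, ((kxi C (d ξ) S - 1 : ℤ) : ℝ) ≤ ∑ v ∈ S, y v) →
      LstarH C (d ξ) w b Hs ≤ ∑ v, w' v * y v := by
    intro ξ y hy hc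
    refine csInf_le ⟨0, ?_⟩ ⟨y, hy, ?_, hw's y⟩
    · rintro r ⟨y, hy, _, rfl⟩
      exact Finset.sum_nonneg fun v _ => mul_nonneg (hwr v) (hy v).1
    · intro q hq
      have := hc _ (Finset.mem_image_of_mem _ hq)
      push_cast at this
      exact this
  have hseg : ∀ x ∈ X, ∀ S ∈ F, S.Nonempty ∧ slk x S ≤ 1 - WOF x Hs := by
    intro x hx S hS
    obtain ⟨q, hq, rfl⟩ := Finset.mem_image.1 hS
    exact aux_seg' (hXsub x hx) Hs hH q hq
  have hW1 : ∀ x ∈ X, 0 ≤ 1 - WOF x Hs := by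
    intro x hx
    have h0 : seg Hs 0 0 ∈ F := by
      refine Finset.mem_image.2 ⟨(0, 0), ?_, rfl⟩
      have := List.length_pos_iff.2 hH.1
      simp [segIdx, this]
    have := hseg x hx _ h0
    exact (aux_slk_nonneg (hXsub x hx) _ this.1).trans this.2
  have hdual := fun ξ => aux_dual F (fun S => kxi C (d ξ) S - 1) w' b hw'0 hb
    (LstarH C (d ξ) w b Hs) (hL0 ξ) (hopt ξ)
  choose α β hα0 hαF hαL hβ hαβ hval using hdual
  have hsc : ∀ ξ v, (p ξ : ℝ) * β ξ v
      + ∑ S ∈ univ.filter (fun S : Finset Vp => v ∈ S), (p ξ : ℝ) * α ξ S ≤ p ξ * w' v := by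
    intro ξ v
    rw [← Finset.mul_sum, ← mul_add]
    exact mul_le_mul_of_nonneg_left (hαβ ξ v) (hpr ξ).le
  refine ⟨fun ξ S => p ξ * α ξ S, fun ξ v => p ξ * β ξ v, ⟨?_, ?_, ?_⟩, ?_, ?_⟩
  · intro ξ S _
    exact mul_nonneg (hpr ξ).le (hα0 ξ S)
  · intro ξ v
    exact mul_nonpos_of_nonneg_of_nonpos (hpr ξ).le (hβ ξ v)
  · intro ξ v hv
    refine (hsc ξ v).trans ?_
    have : w' v ≤ 0 := by simpa [hv] using hw'le v
    exact mul_nonpos_of_nonneg_of_nonpos (hpr ξ).le this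
  · intro x θ hx hθ hcut
    have hphi : ∑ v ∈ univ.filter (fun v => 0 < w v),
        phiv p w (fun ξ S => (p ξ : ℝ) * α ξ S) (fun ξ v => (p ξ : ℝ) * β ξ v) v * θ v
        ≤ ∑ v ∈ VplusH Hs, θ v := by
      have h1 : ∀ v ∈ univ.filter (fun v => 0 < w v),
          phiv p w (fun ξ S => (p ξ : ℝ) * α ξ S) (fun ξ v => (p ξ : ℝ) * β ξ v) v * θ v
          ≤ if v ∈ VplusH Hs then θ v else 0 := by
        intro v hv
        have hwv : (0:ℝ) < w v := by exact_mod_cast (Finset.mem_filter.1 hv).2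
        have h2 : phiv p w (fun ξ S => (p ξ : ℝ) * α ξ S) (fun ξ v => (p ξ : ℝ) * β ξ v) v
            ≤ if v ∈ VplusH Hs then 1 else 0 := by
          unfold phiv
          refine max_le (Finset.sup'_le _ _ fun ξ _ => ?_) (by split_ifs <;> simp)
          rw [div_le_iff₀ (mul_pos (hpr ξ) hwv)]
          refine (hsc ξ v).trans (le_of_eq ?_)
          simp only [hw']
          split_ifs <;> ring
        refine (mul_le_mul_of_nonneg_right h2 (hθ v)).trans (le_of_eq ?_)
        split_ifs <;> simp
      refine (Finset.sum_le_sum h1).trans ?_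
      refine (Finset.sum_le_sum_of_subset_of_nonneg (Finset.filter_subset _ _) ?_).trans
        (le_of_eq ?_)
      · intro v _ _
        split_ifs
        · exact hθ v
        · exact le_rfl
      · simp
    refine le_trans ?_ (hcut.trans hphi)
    have hfil : ∀ (ξ : Sc) (g : Finset Vp → ℝ),
        ∑ S ∈ univ.filter (fun S : Finset Vp => S ≠ ∅), (p ξ : ℝ) * α ξ S * g S
          = p ξ * ∑ S, α ξ S * g S := by
      intro ξ g
      rw [Finset.mul_sum]
      rw [Finset.sum_filter]
      refine Finset.sum_congr rfl fun S _ => ?_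
      split_ifs with h
      · ring
      · have : S ∉ F := fun hS => h (hseg x hx S hS).1.ne_empty
        rw [hαF ξ S this]; ring
    unfold nu
    simp only [hfil]
    rw [Finset.sum_mul, ← add_assoc, ← Finset.sum_add_distrib, ← Finset.sum_add_distrib]
    refine Finset.sum_le_sum fun ξ _ => ?_
    have e1 : ∑ v, (p ξ : ℝ) * β ξ v * (b v : ℝ) = p ξ * ∑ v, β ξ v * (b v : ℝ) := by
      rw [Finset.mul_sum]; exact Finset.sum_congr rfl fun v _ => by ring
    rw [e1, ← mul_add, ← mul_add, mul_assoc]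
    refine mul_le_mul_of_nonneg_left ?_ (hpr ξ).le
    have hv := hval ξ
    have e2 : ∑ S, α ξ S * inSum x S + ∑ S, α ξ S * ((kxi C (d ξ) S : ℝ) - (S.card : ℝ))
        = ∑ S, α ξ S * ((kxi C (d ξ) S - 1 : ℤ) : ℝ) - ∑ S, α ξ S * slk x S := by
      rw [← Finset.sum_add_distrib, ← Finset.sum_sub_distrib]
      refine Finset.sum_congr rfl fun S _ => ?_
      unfold slk
      push_cast
      ring
    have e3 : ∑ S, α ξ S * slk x S ≤ (∑ S, α ξ S) * (1 - WOF x Hs) := by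
      rw [Finset.sum_mul]
      refine Finset.sum_le_sum fun S _ => ?_
      by_cases hS : S ∈ F
      · exact mul_le_mul_of_nonneg_left (hseg x hx S hS).2 (hα0 ξ S)
      · rw [hαF ξ S hS]; simp
    have e4 := mul_le_mul_of_nonneg_right (hαL ξ) (hW1 x hx)
    rw [e2]
    linarith
  · rintro ⟨x, θ⟩ ⟨hx, y, _, hbox, hsri, hθ⟩
    simp only at *
    have hprim : ∀ ξ, LstarH C (d ξ) w b Hs * WOF x Hs
        ≤ ∑ v ∈ VplusH Hs, (w v : ℝ) * y ξ v := by
      intro ξ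
      have := aux_primal F (fun S => kxi C (d ξ) S - 1) w' b hw'0 hb
        (LstarH C (d ξ) w b Hs) (hL0 ξ) (hopt ξ) (y ξ) (hbox ξ) (1 - WOF x Hs) (hW1 x hx) (by
          intro S hS
          have h1 := hseg x hx S hS
          have h2 := hsri S h1.1 ξ
          have h3 := h1.2
          unfold slk at h3
          push_cast
          linarith)
      rw [hw's] at this
      linarith
    calc _ = ∑ ξ, (p ξ : ℝ) * (LstarH C (d ξ) w b Hs * WOF x Hs) := by
          rw [Finset.sum_mul]; exact Finset.sum_congr rfl fun ξ _ => by ring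
      _ ≤ ∑ ξ, (p ξ : ℝ) * ∑ v ∈ VplusH Hs, (w v : ℝ) * y ξ v :=
          Finset.sum_le_sum fun ξ _ => mul_le_mul_of_nonneg_left (hprim ξ) (hpr ξ).le
      _ = ∑ v ∈ VplusH Hs, ∑ ξ, (p ξ : ℝ) * (w v : ℝ) * y ξ v := by
          rw [Finset.sum_comm]
          refine Finset.sum_congr rfl fun ξ _ => ?_
          rw [Finset.mul_sum]
          exact Finset.sum_congr rfl fun v _ => by ring
      _ ≤ _ := Finset.sum_le_sum fun v _ => hθ v

end VRPSD
end

section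
/- For every multiplier pair α ≥ 0, β ≤ 0, and every x ∈ 𝒳 and θ ∈ proj_θ(Γ(x,α,β)), one has cᵀx + Σ_{v∈V₊} θ_v ≥ σ_x(α) + σ_y(α,β) + ν(α,β), where σ_x(α) := inf_{x'∈𝒳} { cᵀx' + Σ_{ξ∈[N]} Σ_{∅⊊S⊆V₊} α^ξ_S·x'(E(S)) } and σ_y(α,β) := inf_{y≥0} Σ_{ξ∈[N]} Σ_{v∈V₊} (p_ξ w_v − β^ξ_v − Σ_{S∋v} α^ξ_S)·y^ξ_v (this infimum equals 0 if all coefficients are nonnegative and −∞ otherwise). -/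
set_option autoImplicit false

open Finset

namespace VRPSD

variable {Vp : Type*} [Fintype Vp] [DecidableEq Vp]
variable {Sc : Type*} [Fintype Sc] [Nonempty Sc]

/-- Theorem 5 of the paper: for every multiplier pair `(α,β)` with `α ≥ 0`
and `β ≤ 0`, and every `x ∈ 𝒳` and `θ ∈ proj_θ(Γ(x,α,β))`,
`cᵀx + Σ_v θ_v ≥ σ_x(α) + σ_y(α,β) + ν(α,β)` (the value `σ_y` is computed in the
extended reals, being `−∞` whenever some reduced cost is negative). -/
theorem statement_18
    (C : ℚ) (hC : 0 < C) (d : Sc → Vp → ℚ)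
    (hd : ∀ ξ v, 0 ≤ d ξ v) (hdC : ∀ ξ v, d ξ v ≤ C)
    (p : Sc → ℚ) (hp : ∀ ξ, 0 < p ξ) (hps : ∑ ξ, p ξ = 1)
    (k : ℕ) (hk : 0 < k)
    (X : Set (Option Vp → Option Vp → ℝ)) (hX : X = Xsub ∨ X = Xcvrp C p d k)
    (w : Vp → ℚ) (hw : ∀ v, 0 ≤ w v) (b : Vp → ℤ) (hb : ∀ v, 0 ≤ b v)
    (c : Option Vp → Option Vp → ℝ) (hcsym : ∀ u v, c u v = c v u) (hc : ∀ u v, 0 ≤ c u v)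
    (α : Sc → Finset Vp → ℝ) (β : Sc → Vp → ℝ)
    (hα : ∀ ξ (S : Finset Vp), S ≠ ∅ → 0 ≤ α ξ S) (hβ : ∀ ξ v, β ξ v ≤ 0)
    (x : Option Vp → Option Vp → ℝ) (hx : x ∈ X)
    (θ : Vp → ℝ) (hθ : ∃ y, (θ, y) ∈ GammaSet C d p w b x α β) :
    ((sInf {r : ℝ | ∃ x' ∈ X,
          r = dotE c x'
            + ∑ ξ, ∑ S ∈ univ.filter (fun S : Finset Vp => S ≠ ∅), α ξ S * inSum x' S}
        : ℝ) : EReal)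
      + (⨅ y : {y : Sc → Vp → ℝ // ∀ ξ v, 0 ≤ y ξ v},
          (((∑ ξ, ∑ v, ((p ξ : ℝ) * (w v : ℝ) - β ξ v
              - ∑ S ∈ univ.filter (fun S : Finset Vp => v ∈ S), α ξ S) * y.1 ξ v) : ℝ)
            : EReal))
      + ((nu C d b α β : ℝ) : EReal)
      ≤ ((dotE c x + ∑ v, θ v : ℝ) : EReal) := by
  obtain ⟨y, -, hbox, h1, h2⟩ := hθ
  simp only at hbox h1 h2
  have hsub : ∀ x' ∈ X, x' ∈ (Xsub : Set (Option Vp → Option Vp → ℝ)) := by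
    intro x' hx'
    rcases hX with h | h
    · rwa [h] at hx'
    · rw [h] at hx'
      exact hx'.1
  have hA : sInf {r : ℝ | ∃ x' ∈ X,
          r = dotE c x'
            + ∑ ξ, ∑ S ∈ univ.filter (fun S : Finset Vp => S ≠ ∅), α ξ S * inSum x' S}
      ≤ dotE c x
            + ∑ ξ, ∑ S ∈ univ.filter (fun S : Finset Vp => S ≠ ∅), α ξ S * inSum x S := by
    refine csInf_le ⟨0, ?_⟩ ⟨x, hx, rfl⟩
    rintro r ⟨x', hx', rfl⟩
    obtain ⟨-, -, h3, -, -⟩ := hsub x' hx'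
    refine add_nonneg ?_ (Finset.sum_nonneg fun ξ _ => Finset.sum_nonneg fun S hS => ?_)
    · refine mul_nonneg (by norm_num) (Finset.sum_nonneg fun u _ => Finset.sum_nonneg fun v hv => ?_)
      exact mul_nonneg (hc u v) (h3 u v (Ne.symm (Finset.mem_filter.mp hv).2)).1
    · refine mul_nonneg (hα ξ S (Finset.mem_filter.mp hS).2) ?_
      refine mul_nonneg (by norm_num) (Finset.sum_nonneg fun u _ => Finset.sum_nonneg fun v hv => ?_)
      refine (h3 (some u) (some v) ?_).1
      intro h
      exact (Finset.mem_filter.mp hv).2 (Option.some.inj h).symm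
  have hB := iInf_le (fun y : {y : Sc → Vp → ℝ // ∀ ξ v, 0 ≤ y ξ v} =>
          (((∑ ξ, ∑ v, ((p ξ : ℝ) * (w v : ℝ) - β ξ v
              - ∑ S ∈ univ.filter (fun S : Finset Vp => v ∈ S), α ξ S) * y.1 ξ v) : ℝ)
            : EReal)) ⟨y, fun ξ v => (hbox ξ v).1⟩
  refine le_trans (add_le_add (add_le_add (EReal.coe_le_coe_iff.mpr hA) hB) le_rfl) ?_
  rw [← EReal.coe_add, ← EReal.coe_add, EReal.coe_le_coe_iff]
  have h4 : ∑ ξ, ∑ v, (p ξ : ℝ) * (w v : ℝ) * y ξ v ≤ ∑ v, θ v := by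
    rw [Finset.sum_comm]
    exact Finset.sum_le_sum fun v _ => h2 v
  have h5 : ∑ ξ, ∑ v, ((p ξ : ℝ) * (w v : ℝ) - β ξ v
              - ∑ S ∈ univ.filter (fun S : Finset Vp => v ∈ S), α ξ S) * y ξ v
      = ∑ ξ, ∑ v, (p ξ : ℝ) * (w v : ℝ) * y ξ v
        - ∑ ξ, ∑ v, (β ξ v + ∑ S ∈ univ.filter (fun S : Finset Vp => v ∈ S), α ξ S) * y ξ v := by
    simp only [← Finset.sum_sub_distrib]
    refine Finset.sum_congr rfl fun ξ _ => Finset.sum_congr rfl fun v _ => ?_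
    ring
  simp only [h5]
  linarith

end VRPSD
end

section
/- For every route R = (v₁,…,v_ℓ) and every (x,θ) ∈ 𝒫, the path cut θ(V₊(R)) ≥ Q*(R)·(1 + Σ_{i=1}^{ℓ−1} (x_{{v_i,v_{i+1}}} − 1)) holds; i.e., the path cuts of the DL-shaped method (with recourse lower bound Q*(R)) are dominated by projected SRIs and hence valid for 𝒫. -/
set_option autoImplicit false

open Finset

namespace VRPSD

theorem aux_floor_int (a : ℝ) :
    IntervalIntegrable (fun t : ℝ => ((⌊a + t⌋ : ℤ) : ℝ)) MeasureTheory.volume 0 1 ∧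
    ∫ t in (0:ℝ)..1, ((⌊a + t⌋ : ℤ) : ℝ) = a := by
  have hm : Monotone (fun t : ℝ => ((⌊a + t⌋ : ℤ) : ℝ)) := by
    intro s t h
    have : ⌊a + s⌋ ≤ ⌊a + t⌋ := Int.floor_le_floor (by linarith)
    show ((⌊a + s⌋ : ℤ) : ℝ) ≤ ((⌊a + t⌋ : ℤ) : ℝ)
    exact_mod_cast this
  have hi : ∀ s t : ℝ, IntervalIntegrable (fun t : ℝ => ((⌊a + t⌋ : ℤ) : ℝ)) MeasureTheory.volume s t :=
    fun s t => hm.intervalIntegrable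
  refine ⟨hi 0 1, ?_⟩
  have f0 := Int.fract_nonneg a
  have f1 := Int.fract_lt_one a
  have fe := Int.floor_add_fract a
  rw [← intervalIntegral.integral_add_adjacent_intervals (hi 0 (1 - Int.fract a)) (hi _ 1)]
  have e1 : ∫ t in (0:ℝ)..(1 - Int.fract a), ((⌊a + t⌋ : ℤ) : ℝ)
      = ∫ t in (0:ℝ)..(1 - Int.fract a), (⌊a⌋ : ℝ) := by
    apply intervalIntegral.integral_congr_Ioo_of_le (by linarith)
    intro t ht
    have : ⌊a + t⌋ = ⌊a⌋ := by
      rw [Int.floor_eq_iff]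
      constructor <;> linarith [ht.1, ht.2]
    simp [this]
  have e2 : ∫ t in (1 - Int.fract a)..1, ((⌊a + t⌋ : ℤ) : ℝ)
      = ∫ t in (1 - Int.fract a)..1, ((⌊a⌋ : ℝ) + 1) := by
    apply intervalIntegral.integral_congr_Ioo_of_le (by linarith)
    intro t ht
    have : ⌊a + t⌋ = ⌊a⌋ + 1 := by
      rw [Int.floor_eq_iff]
      push_cast
      constructor <;> linarith [ht.1, ht.2]
    simp [this]
  rw [e1, e2, intervalIntegral.integral_const, intervalIntegral.integral_const]
  simp only [smul_eq_mul]
  linarith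

theorem aux_sum_Ico (z : ℕ → ℝ) {i j : ℕ} (h : i ≤ j) :
    ∑ t ∈ Ico i j, z t = ∑ t ∈ range j, z t - ∑ t ∈ range i, z t :=
  Finset.sum_Ico_eq_sub z h

theorem aux_round (n : ℕ) (z c : ℕ → ℝ) (b : ℕ → ℤ)
    (hz : ∀ i < n, 0 ≤ z i ∧ z i ≤ b i) :
    ∃ m : ℕ → ℤ, (∀ i < n, 0 ≤ m i ∧ m i ≤ b i) ∧
      (∀ i j, i ≤ j → ∀ K : ℤ, (K : ℝ) ≤ ∑ t ∈ Ico i j, z t → K ≤ ∑ t ∈ Ico i j, m t) ∧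
      ∑ i ∈ range n, c i * (m i : ℝ) ≤ ∑ i ∈ range n, c i * z i := by
  set Z : ℕ → ℝ := fun j => ∑ t ∈ range j, z t with hZ
  have hZs : ∀ i, Z (i+1) = Z i + z i := fun i => Finset.sum_range_succ _ _
  let m : ℝ → ℕ → ℤ := fun τ i => ⌊Z (i+1) + τ⌋ - ⌊Z i + τ⌋
  obtain ⟨τ, hτ⟩ : ∃ τ : ℝ, ∑ i ∈ range n, c i * (m τ i : ℝ) ≤ ∑ i ∈ range n, c i * z i := by
    by_contra! hcon
    have hint : ∀ i, IntervalIntegrable (fun τ => c i * (m τ i : ℝ)) MeasureTheory.volume 0 1 := by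
      intro i
      have := ((aux_floor_int (Z (i+1))).1.sub (aux_floor_int (Z i)).1).const_mul (c i)
      simpa [m] using this
    have hval : ∫ τ in (0:ℝ)..1, ∑ i ∈ range n, c i * (m τ i : ℝ) = ∑ i ∈ range n, c i * z i := by
      rw [intervalIntegral.integral_finsetSum (fun i _ => hint i)]
      refine Finset.sum_congr rfl fun i _ => ?_
      rw [intervalIntegral.integral_const_mul]
      congr 1
      have := intervalIntegral.integral_sub (aux_floor_int (Z (i+1))).1 (aux_floor_int (Z i)).1
      rw [(aux_floor_int (Z (i+1))).2, (aux_floor_int (Z i)).2] at this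
      simp only [m, Int.cast_sub]
      rw [this, hZs]; ring
    have hii : IntervalIntegrable (fun τ => ∑ i ∈ range n, c i * (m τ i : ℝ)) MeasureTheory.volume 0 1 := by
      have := IntervalIntegrable.sum (range n) (fun i _ => hint i)
      simpa [Finset.sum_fn] using this
    have hpos : 0 < ∫ τ in (0:ℝ)..1,
        ((∑ i ∈ range n, c i * (m τ i : ℝ)) - ∑ i ∈ range n, c i * z i) := by
      apply intervalIntegral.intervalIntegral_pos_of_pos_on
      · exact hii.sub intervalIntegrable_const
      · intro τ _; linarith [hcon τ]
      · norm_num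
    rw [intervalIntegral.integral_sub hii intervalIntegrable_const, hval] at hpos
    simp at hpos
  refine ⟨m τ, ?_, ?_, hτ⟩
  · intro i hi
    obtain ⟨h0, h1⟩ := hz i hi
    constructor
    · have : ⌊Z i + τ⌋ ≤ ⌊Z (i+1) + τ⌋ := Int.floor_le_floor (by linarith [hZs i])
      simp only [m]; omega
    · have : ⌊Z (i+1) + τ⌋ ≤ ⌊Z i + τ + (b i : ℤ)⌋ := Int.floor_le_floor (by linarith [hZs i])
      rw [Int.floor_add_intCast] at this
      simp only [m]; omega
  · intro i j hij K hK
    rw [aux_sum_Ico z hij] at hK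
    have e : ∑ t ∈ Ico i j, m τ t = ⌊Z j + τ⌋ - ⌊Z i + τ⌋ :=
      Finset.sum_Ico_sub (fun t => ⌊Z t + τ⌋) hij
    rw [e]
    have : ⌊Z i + τ + (K:ℤ)⌋ ≤ ⌊Z j + τ⌋ := Int.floor_le_floor (by simp only [hZ]; linarith)
    rw [Int.floor_add_intCast] at this
    omega

theorem aux_clip (n : ℕ) (y : ℕ → ℝ) (b : ℕ → ℤ) (W : ℝ) (hW : 0 < W) (hW1 : W ≤ 1)
    (hy : ∀ i < n, 0 ≤ y i ∧ y i ≤ b i) (i j : ℕ) (hj : j ≤ n) (K : ℤ)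
    (hK : (K : ℝ) + (W - 1) ≤ ∑ t ∈ Ico i j, y t) :
    (K : ℝ) ≤ ∑ t ∈ Ico i j, min (y t / W) (b t) := by
  classical
  have hlt : ∀ t ∈ Ico i j, t < n := fun t ht => by
    have := (Finset.mem_Ico.1 ht).2; omega
  rw [← Finset.sum_filter_add_sum_filter_not (Ico i j) (fun t => (b t : ℝ) ≤ y t / W)] at hK ⊢
  have e1 : ∑ t ∈ (Ico i j).filter (fun t => (b t : ℝ) ≤ y t / W), min (y t / W) (b t)
      = ((∑ t ∈ (Ico i j).filter (fun t => (b t : ℝ) ≤ y t / W), b t : ℤ) : ℝ) := by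
    push_cast
    exact Finset.sum_congr rfl fun t ht => min_eq_right (Finset.mem_filter.1 ht).2
  have e2 : ∑ t ∈ (Ico i j).filter (fun t => ¬ (b t : ℝ) ≤ y t / W), min (y t / W) (b t)
      = (∑ t ∈ (Ico i j).filter (fun t => ¬ (b t : ℝ) ≤ y t / W), y t) / W := by
    rw [Finset.sum_div]
    exact Finset.sum_congr rfl fun t ht => min_eq_left (le_of_not_ge (Finset.mem_filter.1 ht).2)
  have h1 : ∑ t ∈ (Ico i j).filter (fun t => (b t : ℝ) ≤ y t / W), y t
      ≤ ((∑ t ∈ (Ico i j).filter (fun t => (b t : ℝ) ≤ y t / W), b t : ℤ) : ℝ) := by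
    push_cast
    exact Finset.sum_le_sum fun t ht => (hy t (hlt t (Finset.mem_filter.1 ht).1)).2
  have h2 : 0 ≤ ∑ t ∈ (Ico i j).filter (fun t => ¬ (b t : ℝ) ≤ y t / W), y t :=
    Finset.sum_nonneg fun t ht => (hy t (hlt t (Finset.mem_filter.1 ht).1)).1
  rw [e1, e2]
  generalize (∑ t ∈ (Ico i j).filter (fun t => (b t : ℝ) ≤ y t / W), b t) = B at *
  generalize (∑ t ∈ (Ico i j).filter (fun t => ¬ (b t : ℝ) ≤ y t / W), y t) = Y at *
  generalize (∑ t ∈ (Ico i j).filter (fun t => (b t : ℝ) ≤ y t / W), y t) = Y1 at *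
  rcases le_or_gt K B with h | h
  · have h3 : (K:ℝ) ≤ B := by exact_mod_cast h
    have : 0 ≤ Y / W := by positivity
    linarith
  · have h3 : (B:ℝ) + 1 ≤ K := by exact_mod_cast h
    have : (K:ℝ) - B ≤ Y / W := by
      rw [le_div_iff₀ hW]
      nlinarith
    linarith

/-- Running load. -/
noncomputable def auxF (C : ℝ) (d y : ℕ → ℝ) : ℕ → ℝ
  | 0 => 0
  | j + 1 => max 0 (auxF C d y j + d j - C * y j)

theorem auxF_nonneg (C : ℝ) (d y : ℕ → ℝ) (j : ℕ) : 0 ≤ auxF C d y j := by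
  cases j <;> simp [auxF]

theorem auxF_eq (C : ℝ) (d y : ℕ → ℝ) (j : ℕ) :
    auxF C d y j = 0 ∨ ∃ i < j, auxF C d y j = ∑ t ∈ Ico i j, (d t - C * y t) := by
  induction j with
  | zero => left; rfl
  | succ j ih =>
    rcases le_total (auxF C d y j + d j - C * y j) 0 with h | h
    · left; simp [auxF, h]
    · right
      have e : auxF C d y (j+1) = auxF C d y j + d j - C * y j := by simp [auxF, h]
      rcases ih with h0 | ⟨i, hi, h0⟩
      · refine ⟨j, by omega, ?_⟩
        rw [e, h0]; simp
      · refine ⟨i, by omega, ?_⟩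
        rw [e, h0, Finset.sum_Ico_succ_top (by omega)]; ring

variable {Vp : Type*} [Fintype Vp] [DecidableEq Vp]

theorem aux_flow (C : ℚ) (hC : 0 < C) (d : Vp → ℚ) (hd : ∀ v, 0 ≤ d v) (L : List Vp)
    (hnd : L.Nodup) (y : Vp → ℝ) (hy : ∀ v, 0 ≤ y v) (e : ℕ → Vp)
    (he : ∀ j : Fin L.length, L.get j = e j)
    (h : ∀ i j, i < j → j ≤ L.length →
      ∑ t ∈ Ico i j, ((d (e t) : ℝ) - (C:ℝ) * y (e t)) ≤ C) :
    FlowFeasible C d L y := by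
  have hCr : (0:ℝ) < C := by exact_mod_cast hC
  set F := auxF (C:ℝ) (fun t => (d (e t) : ℝ)) (fun t => y (e t)) with hF
  have hF0 : ∀ j, 0 ≤ F j := auxF_nonneg _ _ _
  have hFC : ∀ j ≤ L.length, F j ≤ C := by
    intro j hj
    rcases auxF_eq (C:ℝ) (fun t => (d (e t) : ℝ)) (fun t => y (e t)) j with h0 | ⟨i, hi, h0⟩
    · rw [hF, h0]; exact hCr.le
    · rw [hF, h0]; exact h i j hi hj
  have hFs : ∀ j, F (j+1) = max 0 (F j + (d (e j) : ℝ) - C * y (e j)) := fun j => rfl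
  have hidx : ∀ j : Fin L.length, L.idxOf (e j) = j := by
    intro j; rw [← he]; simpa using hnd.idxOf_getElem j.1 j.2
  have hmem : ∀ j : Fin L.length, e j ∈ L := fun j => by rw [← he]; exact List.get_mem L j
  have hnode : ∀ j : Fin L.length, nodeAt L (j.val + 1) = some (e j) := by
    intro j; rw [← he]; simp [nodeAt]
  let f : Option Vp → Option Vp → ℝ := fun a _ =>
    match a with
    | none => 0
    | some v => F (L.idxOf v + 1)
  have hf : ∀ j ≤ L.length, ∀ a, f (nodeAt L j) a = F j := by
    intro j hj a
    cases j with
    | zero => simp [nodeAt, f, hF, auxF]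
    | succ j =>
      rw [hnode ⟨j, hj⟩]
      simp only [f]
      rw [hidx ⟨j, hj⟩]
  refine ⟨f, fun v => if v ∈ L then F (L.idxOf v) + d v - F (L.idxOf v + 1) else 0, ?_, ?_, ?_, ?_, ?_⟩
  · rintro (_ | v) _
    · exact le_rfl
    · exact hF0 _
  · intro v
    beta_reduce
    have hdv : (0:ℝ) ≤ d v := by exact_mod_cast hd v
    by_cases hv : v ∈ L
    · have hev : e (L.idxOf v) = v := by
        rw [← he ⟨L.idxOf v, List.idxOf_lt_length_iff.2 hv⟩]; simp
      have := hFs (L.idxOf v)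
      rw [hev] at this
      rw [if_pos hv, this]
      have : max 0 (F (L.idxOf v) + (d v : ℝ) - C * y v) ≤ F (L.idxOf v) + (d v : ℝ) := by
        apply max_le
        · linarith [hF0 (L.idxOf v)]
        · nlinarith [hy v]
      linarith
    · rw [if_neg hv]
  · intro j
    rw [hf j.val j.2.le (nodeAt L (j.val+1)), hf (j.val+1) j.2 (nodeAt L (j.val+2)), he]
    beta_reduce
    rw [if_pos (hmem j), hidx]; ring
  · intro j
    rw [hf j.val (by omega) (nodeAt L (j.val+1))]; exact hFC _ (by omega)
  · intro j
    rw [he]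
    simp only [if_pos (hmem j), hidx, hFs]
    linarith [le_max_right 0 (F j + (d (e j) : ℝ) - C * y (e j))]

theorem aux_inSum_nonneg_insert (x : Option Vp → Option Vp → ℝ) (hx : x ∈ Xsub)
    (S : Finset Vp) (v : Vp) (hv : v ∉ S) :
    inSum x (insert v S) = inSum x S + ∑ u ∈ S, x (some u) (some v) := by
  obtain ⟨hs, h0, -, -, -⟩ := hx
  have e : ∀ T : Finset Vp, inSum x T = (1/2) * ∑ u ∈ T, ∑ v ∈ T, x (some u) (some v) := by
    intro T
    unfold inSum
    congr 1
    refine Finset.sum_congr rfl fun u _ => ?_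
    rw [Finset.sum_filter]
    refine Finset.sum_congr rfl fun v _ => ?_
    split_ifs with h
    · rfl
    · push Not at h; rw [h, h0]
  rw [e, e, Finset.sum_insert hv]
  simp only [Finset.sum_insert hv, Finset.sum_add_distrib, h0]
  have : ∑ u ∈ S, x (some v) (some u) = ∑ u ∈ S, x (some u) (some v) :=
    Finset.sum_congr rfl fun u _ => hs _ _
  rw [this]; ring

theorem aux_path (x : Option Vp → Option Vp → ℝ) (hx : x ∈ Xsub) (n : ℕ) (e : ℕ → Vp)
    (he : ∀ i < n, ∀ j < n, e i = e j → i = j) (i : ℕ) (j : ℕ) (hij : i ≤ j) (hj : j < n) :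
    ∑ t ∈ Ico i j, x (some (e t)) (some (e (t+1))) ≤ inSum x ((Ico i (j+1)).image e) := by
  induction j, hij using Nat.le_induction with
  | base => simp [inSum, Finset.filter_singleton]
  | succ j hij ih =>
    have hnot : e (j+1) ∉ (Ico i (j+1)).image e := by
      intro h
      obtain ⟨t, ht, h⟩ := Finset.mem_image.1 h
      have h1 := Finset.mem_Ico.1 ht
      have := he t (by omega) (j+1) hj h
      omega
    have e1 : (Ico i (j+1+1)).image e = insert (e (j+1)) ((Ico i (j+1)).image e) := by
      rw [← Finset.image_insert]
      congr 1
      ext t; simp only [Finset.mem_Ico, Finset.mem_insert]; omega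
    rw [e1, aux_inSum_nonneg_insert x hx _ _ hnot, Finset.sum_Ico_succ_top hij]
    have : x (some (e j)) (some (e (j+1))) ≤ ∑ u ∈ (Ico i (j+1)).image e, x (some u) (some (e (j+1))) := by
      apply Finset.single_le_sum (f := fun u => x (some u) (some (e (j+1))))
      · intro u hu
        refine (hx.2.2.1 _ _ ?_).1
        intro h
        rw [Option.some_inj] at h
        exact hnot (h ▸ hu)
      · exact Finset.mem_image_of_mem _ (by simp [hij])
    linarith [ih (by omega)]

theorem aux_scen (C : ℚ) (hC : 0 < C) (d : Vp → ℚ) (hd : ∀ v, 0 ≤ d v)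
    (w : Vp → ℚ) (hw : ∀ v, 0 ≤ w v) (b : Vp → ℤ) (hb : ∀ v, 0 ≤ b v)
    (L : List Vp) (hnd : L.Nodup) (e : ℕ → Vp)
    (he : ∀ j : Fin L.length, L.get j = e j)
    (x : Option Vp → Option Vp → ℝ) (hx : x ∈ Xsub) (W : ℝ) (hW : 0 < W)
    (hWe : W = 1 + ∑ t ∈ range (L.length - 1), (x (some (e t)) (some (e (t+1))) - 1))
    (y : Vp → ℝ) (hy : ∀ v, 0 ≤ y v ∧ y v ≤ b v)
    (hS : ∀ S : Finset Vp, S.Nonempty →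
      ((kxi C d S : ℝ) + inSum x S - (S.card : ℝ)) ≤ ∑ v ∈ S, y v) :
    ∃ y' ∈ RecourseActions C d L, (∀ v, 0 ≤ y' v ∧ y' v ≤ b v) ∧
      W * ∑ v, (w v : ℝ) * y' v ≤ ∑ t ∈ range L.length, (w (e t) : ℝ) * y (e t) := by
  have hCr : (0:ℝ) < C := by exact_mod_cast hC
  set n := L.length with hn
  have hinj : ∀ i < n, ∀ j < n, e i = e j → i = j := by
    intro i hi j hj h
    rw [← he ⟨i, hi⟩, ← he ⟨j, hj⟩] at h
    exact congrArg Fin.val (List.nodup_iff_injective_get.1 hnd h)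
  have hx1 : ∀ t, t + 1 < n → x (some (e t)) (some (e (t+1))) ≤ 1 := by
    intro t ht
    have h1 := aux_path x hx n e hinj t (t+1) (by omega) ht
    have h2 := hx.2.2.2.2 ((Ico t (t+1+1)).image e) (by simp)
    rw [Finset.card_image_of_injOn] at h2
    · simp at h1 h2
      rw [show t + 1 + 1 - t = 2 by omega] at h2
      push_cast at h2
      linarith
    · intro a ha c hc h
      simp only [Finset.coe_Ico, Set.mem_Ico] at ha hc
      exact hinj a (by omega) c (by omega) h
  have hW1 : W ≤ 1 := by
    have : ∑ t ∈ range (n - 1), (x (some (e t)) (some (e (t+1))) - 1) ≤ 0 :=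
      Finset.sum_nonpos fun t ht => by
        have := Finset.mem_range.1 ht
        linarith [hx1 t (by omega)]
    linarith
  have injIco : ∀ i j, j ≤ n → Set.InjOn e (Ico i j : Finset ℕ) := by
    intro i j hj a ha c hc h
    simp only [Finset.coe_Ico, Set.mem_Ico] at ha hc
    exact hinj a (by omega) c (by omega) h
  have key : ∀ i j, i < j → j ≤ n →
      ((kxi C d ((Ico i j).image e) - 1 : ℤ) : ℝ) ≤
        ∑ t ∈ Ico i j, min (y (e t) / W) ((b (e t) : ℤ) : ℝ) := by
    intro i j hij hj
    apply aux_clip n (fun t => y (e t)) (fun t => b (e t)) W hW hW1 (fun t _ => hy _) i j hj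
    obtain ⟨j, rfl⟩ : ∃ j', j = j' + 1 := ⟨j - 1, by omega⟩
    have h1 := aux_path x hx n e hinj i j (by omega) hj
    have h2 := hS ((Ico i (j+1)).image e) (by simpa using hij)
    rw [Finset.card_image_of_injOn (injIco _ _ hj), Finset.sum_image (injIco _ _ hj), Nat.card_Ico,
      Nat.cast_sub (by omega)] at h2
    have h3 : W - 1 ≤ ∑ t ∈ Ico i j, (x (some (e t)) (some (e (t+1))) - 1) := by
      have hsub : Ico i j ⊆ range (n - 1) := by
        intro t ht
        have := Finset.mem_Ico.1 ht
        exact Finset.mem_range.2 (by omega)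
      have := Finset.sum_sdiff (f := fun t => x (some (e t)) (some (e (t+1))) - 1) hsub
      have h4 : ∑ t ∈ range (n-1) \ Ico i j, (x (some (e t)) (some (e (t+1))) - 1) ≤ 0 :=
        Finset.sum_nonpos fun t ht => by
          have := Finset.mem_range.1 (Finset.mem_sdiff.1 ht).1
          linarith [hx1 t (by omega)]
      linarith
    rw [Finset.sum_sub_distrib] at h3
    simp only [Finset.sum_const, Nat.card_Ico, nsmul_eq_mul, mul_one] at h3
    rw [Nat.cast_sub (by omega)] at h3
    push_cast at h2 ⊢
    linarith
  obtain ⟨m, hm1, hm2, hm3⟩ := aux_round n (fun t => min (y (e t) / W) ((b (e t) : ℤ) : ℝ))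
    (fun t => (w (e t) : ℝ)) (fun t => b (e t)) (fun t _ =>
      ⟨le_min (div_nonneg (hy _).1 hW.le) (by exact_mod_cast hb _), min_le_right _ _⟩)
  let y' : Vp → ℝ := fun v => if v ∈ L then (m (L.idxOf v) : ℝ) else 0
  have hy'e : ∀ t < n, y' (e t) = m t := by
    intro t ht
    have h1 : e t ∈ L := by rw [← he ⟨t, ht⟩]; exact List.get_mem L _
    have h2 : L.idxOf (e t) = t := by
      rw [← he ⟨t, ht⟩]; simpa using hnd.idxOf_getElem t ht
    simp only [y', if_pos h1, h2]
  have hex : ∀ v ∈ L, ∃ t < n, e t = v := by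
    intro v hv
    refine ⟨L.idxOf v, List.idxOf_lt_length_iff.2 hv, ?_⟩
    rw [← he ⟨L.idxOf v, List.idxOf_lt_length_iff.2 hv⟩]; simp
  have hbox : ∀ v, 0 ≤ y' v ∧ y' v ≤ b v := by
    intro v
    by_cases hv : v ∈ L
    · obtain ⟨t, ht, rfl⟩ := hex v hv
      rw [hy'e t ht]
      exact_mod_cast hm1 t ht
    · simp only [y', if_neg hv]
      exact ⟨le_rfl, by exact_mod_cast hb v⟩
  refine ⟨y', ⟨fun v => (hbox v).1, ?_, ?_⟩, hbox, ?_⟩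
  · intro v
    by_cases hv : v ∈ L
    · exact ⟨m (L.idxOf v), by simp only [y', if_pos hv]⟩
    · exact ⟨0, by simp only [y', if_neg hv]; simp⟩
  · apply aux_flow C hC d hd L hnd y' (fun v => (hbox v).1) e he
    intro i j hij hj
    have h1 := hm2 i j hij.le _ (key i j hij hj)
    have h2 : (∑ v ∈ (Ico i j).image e, d v) / C ≤ (kxi C d ((Ico i j).image e) : ℚ) := Int.le_ceil _
    rw [div_le_iff₀ hC, Finset.sum_image (injIco _ _ hj)] at h2
    have h3 : (∑ t ∈ Ico i j, (d (e t) : ℝ)) ≤ (kxi C d ((Ico i j).image e) : ℝ) * C := by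
      exact_mod_cast h2
    have h4 : (kxi C d ((Ico i j).image e) : ℝ) - 1 ≤ ∑ t ∈ Ico i j, (m t : ℝ) := by
      exact_mod_cast h1
    rw [Finset.sum_sub_distrib, ← Finset.mul_sum]
    have h5 : ∑ t ∈ Ico i j, y' (e t) = ∑ t ∈ Ico i j, (m t : ℝ) :=
      Finset.sum_congr rfl fun t ht => hy'e t (by have := (Finset.mem_Ico.1 ht).2; omega)
    rw [h5]
    nlinarith
  · have h1 : ∑ v, (w v : ℝ) * y' v = ∑ t ∈ range n, (w (e t) : ℝ) * (m t : ℝ) := by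
      have h2 : ∑ t ∈ range n, (w (e t) : ℝ) * (m t : ℝ) = ∑ v ∈ (range n).image e, (w v : ℝ) * y' v := by
        rw [Finset.sum_image]
        · exact Finset.sum_congr rfl fun t ht => by rw [hy'e t (Finset.mem_range.1 ht)]
        · intro a ha c hc h
          exact hinj a (by simpa using ha) c (by simpa using hc) h
      rw [h2]
      symm
      apply Finset.sum_subset (Finset.subset_univ _)
      intro v _ hv
      have : v ∉ L := by
        intro h
        obtain ⟨t, ht, rfl⟩ := hex v h
        exact hv (Finset.mem_image_of_mem _ (Finset.mem_range.2 ht))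
      simp [y', this]
    rw [h1]
    calc W * ∑ t ∈ range n, (w (e t) : ℝ) * (m t : ℝ)
        ≤ W * ∑ t ∈ range n, (w (e t) : ℝ) * min (y (e t) / W) ((b (e t) : ℤ) : ℝ) :=
          mul_le_mul_of_nonneg_left hm3 hW.le
      _ ≤ _ := by
          rw [Finset.mul_sum]
          refine Finset.sum_le_sum fun t _ => ?_
          have h2 : (0:ℝ) ≤ w (e t) := by exact_mod_cast hw _
          have h3 : W * min (y (e t) / W) ((b (e t) : ℤ) : ℝ) ≤ y (e t) := by
            calc _ ≤ W * (y (e t) / W) := mul_le_mul_of_nonneg_left (min_le_left _ _) hW.le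
              _ = _ := by field_simp
          nlinarith

end VRPSD

namespace VRPSD

variable {Vp : Type*} [Fintype Vp] [DecidableEq Vp]
variable {Sc : Type*} [Fintype Sc] [Nonempty Sc]

/-- Corollary 2(b) of the paper: the path cuts of the DL-shaped method with
recourse lower bound `Q*(R)` are valid for `𝒫`. -/
theorem statement_19
    (C : ℚ) (hC : 0 < C) (d : Sc → Vp → ℚ)
    (hd : ∀ ξ v, 0 ≤ d ξ v) (hdC : ∀ ξ v, d ξ v ≤ C)
    (p : Sc → ℚ) (hp : ∀ ξ, 0 < p ξ) (hps : ∑ ξ, p ξ = 1)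
    (k : ℕ) (hk : 0 < k)
    (X : Set (Option Vp → Option Vp → ℝ)) (hX : X = Xsub ∨ X = Xcvrp C p d k)
    (w : Vp → ℚ) (hw : ∀ v, 0 ≤ w v) (b : Vp → ℤ) (hb : ∀ v, 0 ≤ b v)
    (hne : ∀ L : List Vp, L ≠ [] → L.Nodup → (Policies C d L ∩ Box b).Nonempty)
    (L : List Vp) (hL : L ≠ []) (hnd : L.Nodup)
    (x : Option Vp → Option Vp → ℝ) (θ : Vp → ℝ)
    (hmem : (x, θ) ∈ Pset X C d p w b) :
    (sInf {r : ℝ | ∃ y ∈ Policies C d L ∩ Box b, r = cost p w y})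
        * (1 + ∑ i : Fin (L.length - 1),
            (x (some (L.get ⟨i.val, by have := i.isLt; omega⟩))
               (some (L.get ⟨i.val + 1, by have := i.isLt; omega⟩)) - 1))
      ≤ (L.map θ).sum := by
  have hxs : x ∈ Xsub := by
    rcases hX with rfl | rfl
    · exact hmem.1
    · exact hmem.1.1
  obtain ⟨-, y, hθ, hybox, hS, hθy⟩ := hmem
  simp only at hθ hybox hS hθy
  have hbdd : ∀ r ∈ {r : ℝ | ∃ y ∈ Policies C d L ∩ Box b, r = cost p w y}, 0 ≤ r := by
    rintro r ⟨z, hz, rfl⟩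
    refine Finset.sum_nonneg fun ξ _ => Finset.sum_nonneg fun v _ => ?_
    have h1 : (0:ℝ) ≤ p ξ := by exact_mod_cast (hp ξ).le
    have h2 : (0:ℝ) ≤ w v := by exact_mod_cast hw v
    exact mul_nonneg (mul_nonneg h1 h2) (hz.2 ξ v).1
  have hQ : 0 ≤ sInf {r : ℝ | ∃ y ∈ Policies C d L ∩ Box b, r = cost p w y} :=
    Real.sInf_nonneg hbdd
  have hθ0 : 0 ≤ (L.map θ).sum := by
    apply List.sum_nonneg
    intro a ha
    obtain ⟨v, -, rfl⟩ := List.mem_map.1 ha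
    exact hθ v
  let e : ℕ → Vp := fun i => L.getD i (L.head hL)
  have he : ∀ j : Fin L.length, L.get j = e j := by
    intro j; simp [e]
  have hθe : (L.map θ).sum = ∑ t ∈ range L.length, θ (e t) := by
    rw [Finset.sum_range, ← List.sum_ofFn]
    congr 1
    conv_lhs => rw [← List.ofFn_get L, List.map_ofFn]
    congr 1
    funext j
    simp only [Function.comp, he]
  have hWeq : (1 + ∑ i : Fin (L.length - 1),
            (x (some (L.get ⟨i.val, by have := i.isLt; omega⟩))
               (some (L.get ⟨i.val + 1, by have := i.isLt; omega⟩)) - 1))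
      = 1 + ∑ t ∈ range (L.length - 1), (x (some (e t)) (some (e (t+1))) - 1) := by
    rw [Finset.sum_range]
    congr 1
    refine Finset.sum_congr rfl fun i _ => ?_
    rw [he, he]
  rw [hWeq]
  generalize hWd : 1 + ∑ t ∈ range (L.length - 1), (x (some (e t)) (some (e (t+1))) - 1) = W
  rcases le_or_gt W 0 with hW | hW
  · exact (mul_nonpos_of_nonneg_of_nonpos hQ hW).trans hθ0
  have hsc := fun ξ => aux_scen C hC (d ξ) (hd ξ) w hw b hb L hnd e he x hxs W hW hWd.symm
    (y ξ) (hybox ξ) (fun S hSn => hS S hSn ξ)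
  choose z hz1 hz2 hz3 using hsc
  have hle : sInf {r : ℝ | ∃ y ∈ Policies C d L ∩ Box b, r = cost p w y} ≤ cost p w z :=
    csInf_le ⟨0, hbdd⟩ ⟨z, ⟨hz1, hz2⟩, rfl⟩
  rw [hθe]
  calc _ ≤ cost p w z * W := mul_le_mul_of_nonneg_right hle hW.le
    _ = ∑ ξ, (p ξ : ℝ) * (W * ∑ v, (w v : ℝ) * z ξ v) := by
        unfold cost
        rw [Finset.sum_mul]
        refine Finset.sum_congr rfl fun ξ _ => ?_
        simp only [Finset.mul_sum, Finset.sum_mul]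
        exact Finset.sum_congr rfl fun v _ => by ring
    _ ≤ ∑ ξ, (p ξ : ℝ) * ∑ t ∈ range L.length, (w (e t) : ℝ) * y ξ (e t) :=
        Finset.sum_le_sum fun ξ _ =>
          mul_le_mul_of_nonneg_left (hz3 ξ) (by exact_mod_cast (hp ξ).le)
    _ = ∑ t ∈ range L.length, ∑ ξ, (p ξ : ℝ) * (w (e t) : ℝ) * y ξ (e t) := by
        simp only [Finset.mul_sum]
        rw [Finset.sum_comm]
        exact Finset.sum_congr rfl fun t _ => Finset.sum_congr rfl fun ξ _ => by ring
    _ ≤ _ := Finset.sum_le_sum fun t _ => hθy _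

end VRPSD
end
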